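/- arXiv:2102.09593 — 8 statements merged into one kernel-verified Lean document; each statement's English description precedes it below -/
import Mathlib

section
/- Let X be an involutory Hopf algebra over a commutative ring k (i.e. S ∘ S = id). Then the quantum heap operation T(x⊗y⊗z) = x·S(y)·z is ternary self-distributive: for all x, y, z, u, v ∈ X, x·S(y)·z·S(u)·v = (x·S(u⁽¹⁾)·v⁽¹⁾) · S( y·S(u⁽²⁾)·v⁽²⁾ ) · (z·S(u⁽³⁾)·v⁽³⁾), as an identity of k-linear maps X^{⊗5} → X. -/
open TensorProduct

/-- The twofold iterated comultiplication `x ↦ x⁽¹⁾ ⊗ (x⁽²⁾ ⊗ x⁽³⁾)`. -/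
noncomputable def delta3 (k : Type*) {X : Type*} [CommRing k] [AddCommMonoid X] [Module k X]
    [Coalgebra k X] : X →ₗ[k] X ⊗[k] (X ⊗[k] X) :=
  (LinearMap.lTensor X (Coalgebra.comul (R := k))) ∘ₗ Coalgebra.comul

/-- The finite family `(x1 i) ⊗ (x2 i) ⊗ (x3 i)` represents the iterated comultiplication
`x⁽¹⁾ ⊗ x⁽²⁾ ⊗ x⁽³⁾` of `x` (Sweedler notation with suppressed summation). -/
def Rep3 (k : Type*) {X : Type*} [CommRing k] [AddCommMonoid X] [Module k X] [Coalgebra k X]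
    (x : X) {n : ℕ} (x1 x2 x3 : Fin n → X) : Prop :=
  delta3 k x = ∑ i, x1 i ⊗ₜ[k] (x2 i ⊗ₜ[k] x3 i)

section SweedlerCancellation

variable {k X : Type*} [CommRing k] [Ring X] [HopfAlgebra k X]

/-- If `f` is a linear map with `f (x⁽¹⁾ ⊗ x⁽²⁾) = ε(x) 1`, then
`f (x⁽¹⁾ ⊗ x⁽²⁾) ⊗ x⁽³⁾ = 1 ⊗ x`. -/
theorem Rep3.sum_tmul_eq_one_tmul {f : X ⊗[k] X →ₗ[k] X}
    (hf : f ∘ₗ Coalgebra.comul = Algebra.linearMap k X ∘ₗ Coalgebra.counit)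
    {x : X} {n : ℕ} {x1 x2 x3 : Fin n → X} (hx : Rep3 k x x1 x2 x3) :
    ∑ i, f (x1 i ⊗ₜ[k] x2 i) ⊗ₜ[k] x3 i = (1 : X) ⊗ₜ[k] x := by
  have h := congrArg (fun t => f.rTensor X ((TensorProduct.assoc k X X X).symm t)) hx
  simp only [delta3, LinearMap.comp_apply, Coalgebra.coassoc_symm_apply, map_sum,
    TensorProduct.assoc_symm_tmul, LinearMap.rTensor_tmul] at h
  rw [← h, ← LinearMap.rTensor_comp_apply, hf, LinearMap.rTensor_comp_apply,
    Coalgebra.rTensor_counit_comul, LinearMap.rTensor_tmul]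
  simp

/-- `g (x⁽¹⁾ S(x⁽²⁾)) x⁽³⁾ = g 1 x` for bilinear `g`. -/
theorem Rep3.sum_mul_antipode {x : X} {n : ℕ} {x1 x2 x3 : Fin n → X}
    (hx : Rep3 k x x1 x2 x3) (g : X →ₗ[k] X →ₗ[k] X) :
    ∑ i, g (x1 i * HopfAlgebra.antipode k (x2 i)) (x3 i) = g 1 x := by
  simpa using congrArg (TensorProduct.lift g)
    (hx.sum_tmul_eq_one_tmul (f := LinearMap.mul' k X ∘ₗ (HopfAlgebra.antipode k).lTensor X)
      HopfAlgebra.mul_antipode_lTensor_comul)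

/-- `g (S(x⁽¹⁾) x⁽²⁾) x⁽³⁾ = g 1 x` for bilinear `g`. -/
theorem Rep3.sum_antipode_mul {x : X} {n : ℕ} {x1 x2 x3 : Fin n → X}
    (hx : Rep3 k x x1 x2 x3) (g : X →ₗ[k] X →ₗ[k] X) :
    ∑ i, g (HopfAlgebra.antipode k (x1 i) * x2 i) (x3 i) = g 1 x := by
  simpa using congrArg (TensorProduct.lift g)
    (hx.sum_tmul_eq_one_tmul (f := LinearMap.mul' k X ∘ₗ (HopfAlgebra.antipode k).rTensor X)
      HopfAlgebra.mul_antipode_rTensor_comul)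

end SweedlerCancellation

/-- in an involutory Hopf algebra, the quantum heap operation
`T(x⊗y⊗z) = x·S(y)·z` is ternary self-distributive. -/
theorem quantum_heap_TSD (k X : Type*) [CommRing k] [Ring X] [HopfAlgebra k X]
    (S : X →ₗ[k] X) (hS : S = HopfAlgebra.antipode (R := k))
    (hinv : ∀ a : X, S (S a) = a)
    (x y z u v : X) {n m : ℕ} (u1 u2 u3 : Fin n → X) (v1 v2 v3 : Fin m → X)
    (hu : Rep3 k u u1 u2 u3) (hv : Rep3 k v v1 v2 v3) :
    x * S y * z * S u * v =
      ∑ i, ∑ j, (x * S (u1 i) * v1 j) * S (y * S (u2 i) * v2 j) * (z * S (u3 i) * v3 j) := by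
  subst hS
  have expand (a b c d e f : X) :
      (x * HopfAlgebra.antipode k a * d) * HopfAlgebra.antipode k
          (y * HopfAlgebra.antipode k b * e) * (z * HopfAlgebra.antipode k c * f) =
        x * HopfAlgebra.antipode k a * (d * HopfAlgebra.antipode k e) *
          (b * HopfAlgebra.antipode k y * z * HopfAlgebra.antipode k c) * f := by
    simp only [HopfAlgebra.antipode_mul_antidistrib, hinv, mul_assoc]
  simp only [expand]
  have cancel_v (a b : X) :
      ∑ j, a * (v1 j * HopfAlgebra.antipode k (v2 j)) * b * v3 j = a * b * v := by
    simpa using hv.sum_mul_antipode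
      (LinearMap.mul k X ∘ₗ LinearMap.mulRight k b ∘ₗ LinearMap.mulLeft k a)
  simp only [cancel_v]
  have cancel_u (a b : X) :
      ∑ i, a * (HopfAlgebra.antipode k (u1 i) * u2 i) * b * HopfAlgebra.antipode k (u3 i) =
        a * b * HopfAlgebra.antipode k u := by
    simpa using hu.sum_antipode_mul
      ((LinearMap.mul k X ∘ₗ LinearMap.mulRight k b ∘ₗ LinearMap.mulLeft k a).compl₂
        (HopfAlgebra.antipode k))
  rw [← Finset.sum_mul]
  simpa only [mul_assoc] using (congrArg (· * v) (cancel_u x (HopfAlgebra.antipode k y * z))).symm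
end

section
/- Let X be a cocommutative involutory Hopf algebra over a commutative ring k. Then the quantum heap operation T(x⊗y⊗z) = x·S(y)·z is invertible: for all x, y, z ∈ X, ( x·S(y⁽²⁾)·z⁽²⁾ )·S(z⁽¹⁾)·y⁽¹⁾ = ε(y)ε(z)·x, as an identity of k-linear maps X^{⊗3} → X. -/
open TensorProduct

/-- The finite family `(x1 i) ⊗ (x2 i)` represents the comultiplication
`x⁽¹⁾ ⊗ x⁽²⁾` of `x` (Sweedler notation with suppressed summation). -/
def Rep2 (k : Type*) {X : Type*} [CommRing k] [AddCommMonoid X] [Module k X] [Coalgebra k X]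
    (x : X) {n : ℕ} (x1 x2 : Fin n → X) : Prop :=
  Coalgebra.comul (R := k) x = ∑ i, x1 i ⊗ₜ[k] x2 i

/-- In a cocommutative Hopf algebra, `a⁽²⁾ · S(a⁽¹⁾) = ε(a)`. -/
theorem Rep2.sum_mul_antipode_of_comm {k X : Type*} [CommRing k] [Ring X] [HopfAlgebra k X]
    {a : X} (hcc : TensorProduct.comm k X X (Coalgebra.comul a) = Coalgebra.comul a)
    {n : ℕ} {a1 a2 : Fin n → X} (ha : Rep2 k a a1 a2) :
    ∑ i, a2 i * HopfAlgebra.antipode k (a1 i) = algebraMap k X (Coalgebra.counit a) := by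
  rw [← HopfAlgebra.mul_antipode_lTensor_comul_apply, ← hcc, show Coalgebra.comul a = _ from ha]
  simp

/-- In a cocommutative Hopf algebra, `S(a⁽²⁾) · a⁽¹⁾ = ε(a)`. -/
theorem Rep2.sum_antipode_mul_of_comm {k X : Type*} [CommRing k] [Ring X] [HopfAlgebra k X]
    {a : X} (hcc : TensorProduct.comm k X X (Coalgebra.comul a) = Coalgebra.comul a)
    {n : ℕ} {a1 a2 : Fin n → X} (ha : Rep2 k a a1 a2) :
    ∑ i, HopfAlgebra.antipode k (a2 i) * a1 i = algebraMap k X (Coalgebra.counit a) := by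
  rw [← HopfAlgebra.mul_antipode_rTensor_comul_apply, ← hcc, show Coalgebra.comul a = _ from ha]
  simp

/-- in a cocommutative involutory Hopf algebra, the quantum heap operation
`T(x⊗y⊗z) = x·S(y)·z` is invertible:
`(x·S(y⁽²⁾)·z⁽²⁾)·S(z⁽¹⁾)·y⁽¹⁾ = ε(y)ε(z)·x`. -/
theorem quantum_heap_invertible (k X : Type*) [CommRing k] [Ring X] [HopfAlgebra k X]
    (S : X →ₗ[k] X) (hS : S = HopfAlgebra.antipode (R := k))
    (hinv : ∀ a : X, S (S a) = a)
    (hcc : ∀ a : X, TensorProduct.comm k X X (Coalgebra.comul a) = Coalgebra.comul a)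
    (x y z : X) {n m : ℕ} (y1 y2 : Fin n → X) (z1 z2 : Fin m → X)
    (hy : Rep2 k y y1 y2) (hz : Rep2 k z z1 z2) :
    ∑ i, ∑ j, (x * S (y2 i) * z2 j) * S (z1 j) * y1 i =
      (Coalgebra.counit (R := k) y * Coalgebra.counit (R := k) z) • x := by
  subst hS
  have inner (i : Fin n) :
      ∑ j, (x * HopfAlgebra.antipode k (y2 i) * z2 j) * HopfAlgebra.antipode k (z1 j) * y1 i =
        Coalgebra.counit (R := k) z • (x * (HopfAlgebra.antipode k (y2 i) * y1 i)) := by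
    rw [← Finset.sum_mul]
    simp_rw [mul_assoc _ (z2 _)]
    rw [← Finset.mul_sum, hz.sum_mul_antipode_of_comm (hcc z), ← Algebra.commutes,
      ← Algebra.smul_def, smul_mul_assoc, mul_assoc]
  simp_rw [inner]
  rw [← Finset.smul_sum, ← Finset.mul_sum, hy.sum_antipode_mul_of_comm (hcc y),
    ← Algebra.commutes, ← Algebra.smul_def, smul_smul, mul_comm]
end

section
/- Let (X, Δ, ε) be a cocommutative coalgebra over a commutative ring k and let T : X⊗X⊗X → X be an invertible ternary self-distributive coalgebra morphism. Define k-linear maps β₁, β₁' : X^{⊗3} → X^{⊗3} by β₁(x⊗y⊗z) = y⁽¹⁾ ⊗ z⁽¹⁾ ⊗ T(x⊗y⁽²⁾⊗z⁽²⁾) and β₁'(y⊗z⊗x) = T(x⊗z⁽²⁾⊗y⁽²⁾) ⊗ y⁽¹⁾ ⊗ z⁽¹⁾. Then β₁' ∘ β₁ = id and β₁ ∘ β₁' = id on X^{⊗3}; in particular β₁ is invertible with inverse β₁'. -/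
open TensorProduct

/-- `T` is ternary self-distributive. -/
def IsTSD (k : Type*) {X : Type*} [CommRing k] [AddCommMonoid X] [Module k X] [Coalgebra k X]
    (T : X ⊗[k] (X ⊗[k] X) →ₗ[k] X) : Prop :=
  ∀ (x y z u v : X) {n m : ℕ} (u1 u2 u3 : Fin n → X) (v1 v2 v3 : Fin m → X),
    Rep3 k u u1 u2 u3 → Rep3 k v v1 v2 v3 →
    T (T (x ⊗ₜ[k] (y ⊗ₜ[k] z)) ⊗ₜ[k] (u ⊗ₜ[k] v)) =
      ∑ i, ∑ j, T (T (x ⊗ₜ[k] (u1 i ⊗ₜ[k] v1 j)) ⊗ₜ[k]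
        (T (y ⊗ₜ[k] (u2 i ⊗ₜ[k] v2 j)) ⊗ₜ[k] T (z ⊗ₜ[k] (u3 i ⊗ₜ[k] v3 j))))

/-- `T` is invertible: `T(T(x⊗y⁽²⁾⊗z⁽²⁾)⊗z⁽¹⁾⊗y⁽¹⁾) = ε(y)ε(z)·x`. -/
def IsInvertibleTSD (k : Type*) {X : Type*} [CommRing k] [AddCommMonoid X] [Module k X]
    [Coalgebra k X] (T : X ⊗[k] (X ⊗[k] X) →ₗ[k] X) : Prop :=
  ∀ (x y z : X) {n m : ℕ} (y1 y2 : Fin n → X) (z1 z2 : Fin m → X),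
    Rep2 k y y1 y2 → Rep2 k z z1 z2 →
    ∑ i, ∑ j, T (T (x ⊗ₜ[k] (y2 i ⊗ₜ[k] z2 j)) ⊗ₜ[k] (z1 j ⊗ₜ[k] y1 i)) =
      (Coalgebra.counit (R := k) y * Coalgebra.counit (R := k) z) • x

/-- `T` is a coalgebra morphism. -/
def IsCoalgMor (k : Type*) {X : Type*} [CommRing k] [AddCommMonoid X] [Module k X]
    [Coalgebra k X] (T : X ⊗[k] (X ⊗[k] X) →ₗ[k] X) : Prop :=
  (∀ x y z : X, Coalgebra.counit (R := k) (T (x ⊗ₜ[k] (y ⊗ₜ[k] z))) =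
      Coalgebra.counit (R := k) x * Coalgebra.counit (R := k) y * Coalgebra.counit (R := k) z) ∧
  (∀ (x y z : X) {n₁ n₂ n₃ : ℕ} (x1 x2 : Fin n₁ → X) (y1 y2 : Fin n₂ → X) (z1 z2 : Fin n₃ → X),
    Rep2 k x x1 x2 → Rep2 k y y1 y2 → Rep2 k z z1 z2 →
    Coalgebra.comul (R := k) (T (x ⊗ₜ[k] (y ⊗ₜ[k] z))) =
      ∑ i, ∑ j, ∑ l, T (x1 i ⊗ₜ[k] (y1 j ⊗ₜ[k] z1 l)) ⊗ₜ[k] T (x2 i ⊗ₜ[k] (y2 j ⊗ₜ[k] z2 l)))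

open Coalgebra in
/-- Coassociativity, evaluated on a trilinear map. -/
lemma Rep2.sum_coassoc {k X M : Type*} [CommRing k] [AddCommGroup X] [Module k X]
    [Coalgebra k X] [AddCommGroup M] [Module k M] {y : X} {n : ℕ} {y1 y2 : Fin n → X}
    (hy : Rep2 k y y1 y2) {l r : Fin n → ℕ}
    {a b : (i : Fin n) → Fin (l i) → X} (hl : ∀ i, Rep2 k (y1 i) (a i) (b i))
    {c d : (i : Fin n) → Fin (r i) → X} (hr : ∀ i, Rep2 k (y2 i) (c i) (d i))
    (f : X → X → X → M) (h1 : ∀ v w, IsLinearMap k fun u ↦ f u v w)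
    (h2 : ∀ u w, IsLinearMap k fun v ↦ f u v w) (h3 : ∀ u v, IsLinearMap k (f u v)) :
    ∑ i, ∑ p, f (a i p) (b i p) (y2 i) = ∑ i, ∑ p, f (y1 i) (c i p) (d i p) := by
  let g : X →ₗ[k] X ⊗[k] X →ₗ[k] M := LinearMap.mk₂ k (fun u t ↦ TensorProduct.lift
      (LinearMap.mk₂ k (f u) (fun v v' w ↦ (h2 u w).map_add v v')
        (fun s v w ↦ (h2 u w).map_smul s v) (fun v w w' ↦ (h3 u v).map_add w w')
        (fun s v w ↦ (h3 u v).map_smul s w)) t)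
    (fun u u' t ↦ by
      induction t with
      | zero => simp
      | tmul v w => simpa using (h1 v w).map_add u u'
      | add t t' ht ht' => simp only [map_add, ht, ht']; abel)
    (fun s u t ↦ by
      induction t with
      | zero => simp
      | tmul v w => simpa using (h1 v w).map_smul s u
      | add t t' ht ht' => simp only [map_add, ht, ht', smul_add])
    (fun u t t' ↦ map_add _ t t') (fun s u t ↦ map_smul _ s t)
  have h := congrArg (TensorProduct.lift g) (coassoc_apply (R := k) y)
  rw [show comul (R := k) y = _ from hy] at h
  simp only [map_sum, LinearMap.rTensor_tmul, LinearMap.lTensor_tmul] at h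
  simp only [show ∀ i, comul (R := k) (y1 i) = _ from hl,
    show ∀ i, comul (R := k) (y2 i) = _ from hr, sum_tmul, tmul_sum, map_sum] at h
  simpa [g] using h

lemma exists_rep2 (k : Type*) {X : Type*} [CommRing k] [AddCommGroup X] [Module k X]
    [Coalgebra k X] (x : X) : ∃ (n : ℕ) (x1 x2 : Fin n → X), Rep2 k x x1 x2 :=
  TensorProduct.exists_sum_tmul_eq _

open Coalgebra in
lemma Rep2.sum_counit_smul {k X : Type*} [CommRing k] [AddCommGroup X] [Module k X]
    [Coalgebra k X] {x : X} {n : ℕ} {x1 x2 : Fin n → X} (h : Rep2 k x x1 x2) :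
    ∑ i, counit (R := k) (x2 i) • x1 i = x := by
  have e := congrArg (TensorProduct.rid k X) (lTensor_counit_comul (R := k) x)
  rw [show comul (R := k) x = _ from h] at e
  simpa using e

/-- Acting by `y⁽³⁾ ⊗ z⁽³⁾` and then by `z⁽²⁾ ⊗ y⁽²⁾` is trivial, in the presence of the
remaining legs `y⁽¹⁾` and `z⁽¹⁾`. -/
lemma IsInvertibleTSD.sum_cancel {k X M : Type*} [CommRing k] [AddCommGroup X] [Module k X]
    [Coalgebra k X] [AddCommGroup M] [Module k M] {T : X ⊗[k] (X ⊗[k] X) →ₗ[k] X}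
    (hT : IsInvertibleTSD k T) (Φ : X ⊗[k] (X ⊗[k] X) →ₗ[k] M) (x : X)
    {y z : X} {n m : ℕ} {y1 y2 : Fin n → X} {z1 z2 : Fin m → X}
    (hy : Rep2 k y y1 y2) (hz : Rep2 k z z1 z2)
    {l : Fin n → ℕ} {a b : (i : Fin n) → Fin (l i) → X} (hab : ∀ i, Rep2 k (y1 i) (a i) (b i))
    {r : Fin m → ℕ} {c d : (j : Fin m) → Fin (r j) → X} (hcd : ∀ j, Rep2 k (z1 j) (c j) (d j)) :
    ∑ i, ∑ j, ∑ p, ∑ q, Φ (a i p ⊗ₜ[k] (c j q ⊗ₜ[k]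
      T (T (x ⊗ₜ[k] (y2 i ⊗ₜ[k] z2 j)) ⊗ₜ[k] (d j q ⊗ₜ[k] b i p)))) =
    Φ (y ⊗ₜ[k] (z ⊗ₜ[k] x)) := by
  choose l' a' b' hab' using fun i ↦ exists_rep2 k (y2 i)
  choose r' c' d' hcd' using fun j ↦ exists_rep2 k (z2 j)
  calc
    _ = ∑ j, ∑ q, ∑ i, ∑ p, Φ (a i p ⊗ₜ[k] (c j q ⊗ₜ[k]
          T (T (x ⊗ₜ[k] (y2 i ⊗ₜ[k] z2 j)) ⊗ₜ[k] (d j q ⊗ₜ[k] b i p)))) := by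
      rw [Finset.sum_comm]
      refine Finset.sum_congr rfl fun j _ ↦ ?_
      rw [Finset.sum_comm]
      exact Finset.sum_congr rfl fun i _ ↦ Finset.sum_comm
    _ = ∑ j, ∑ q, ∑ i, ∑ p, Φ (y1 i ⊗ₜ[k] (c j q ⊗ₜ[k]
          T (T (x ⊗ₜ[k] (b' i p ⊗ₜ[k] z2 j)) ⊗ₜ[k] (d j q ⊗ₜ[k] a' i p)))) := by
      refine Finset.sum_congr rfl fun j _ ↦ Finset.sum_congr rfl fun q _ ↦ ?_
      refine hy.sum_coassoc hab hab' (fun u v w ↦ Φ (u ⊗ₜ[k] (c j q ⊗ₜ[k]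
          T (T (x ⊗ₜ[k] (w ⊗ₜ[k] z2 j)) ⊗ₜ[k] (d j q ⊗ₜ[k] v))))) ?_ ?_ ?_ <;>
        intros <;> constructor <;> intros <;>
        simp only [tmul_add, add_tmul, map_add, ← smul_tmul', tmul_smul, map_smul]
    _ = ∑ i, ∑ p, ∑ j, ∑ q, Φ (y1 i ⊗ₜ[k] (c j q ⊗ₜ[k]
          T (T (x ⊗ₜ[k] (b' i p ⊗ₜ[k] z2 j)) ⊗ₜ[k] (d j q ⊗ₜ[k] a' i p)))) := by
      refine (Finset.sum_congr rfl fun j _ ↦ Finset.sum_comm.trans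
        (Finset.sum_congr rfl fun i _ ↦ Finset.sum_comm)).trans ?_
      exact Finset.sum_comm.trans (Finset.sum_congr rfl fun i _ ↦ Finset.sum_comm)
    _ = ∑ i, ∑ p, ∑ j, ∑ q, Φ (y1 i ⊗ₜ[k] (z1 j ⊗ₜ[k]
          T (T (x ⊗ₜ[k] (b' i p ⊗ₜ[k] d' j q)) ⊗ₜ[k] (c' j q ⊗ₜ[k] a' i p)))) := by
      refine Finset.sum_congr rfl fun i _ ↦ Finset.sum_congr rfl fun p _ ↦ ?_
      refine hz.sum_coassoc hcd hcd' (fun u v w ↦ Φ (y1 i ⊗ₜ[k] (u ⊗ₜ[k]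
          T (T (x ⊗ₜ[k] (b' i p ⊗ₜ[k] w)) ⊗ₜ[k] (v ⊗ₜ[k] a' i p))))) ?_ ?_ ?_ <;>
        intros <;> constructor <;> intros <;>
        simp only [tmul_add, add_tmul, map_add, ← smul_tmul', tmul_smul, map_smul]
    _ = ∑ i, ∑ j, Φ (y1 i ⊗ₜ[k] (z1 j ⊗ₜ[k] ∑ p, ∑ q,
          T (T (x ⊗ₜ[k] (b' i p ⊗ₜ[k] d' j q)) ⊗ₜ[k] (c' j q ⊗ₜ[k] a' i p)))) := by
      refine Finset.sum_congr rfl fun i _ ↦ ?_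
      rw [Finset.sum_comm]
      simp only [tmul_sum, map_sum]
    _ = Φ ((∑ i, Coalgebra.counit (R := k) (y2 i) • y1 i) ⊗ₜ[k]
          ((∑ j, Coalgebra.counit (R := k) (z2 j) • z1 j) ⊗ₜ[k] x)) := by
      simp only [hT x _ _ _ _ _ _ (hab' _) (hcd' _), sum_tmul, tmul_sum, map_sum, tmul_smul,
        map_smul, ← smul_tmul', mul_smul, Finset.smul_sum]
      rw [Finset.sum_comm]
      exact Finset.sum_congr rfl fun j _ ↦ Finset.sum_congr rfl fun i _ ↦ smul_comm _ _ _
    _ = _ := by rw [hy.sum_counit_smul, hz.sum_counit_smul]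

/-- the single-strand braiding `β₁` is invertible with inverse `β₁'`. -/
theorem single_strand_braiding_invertible (k X : Type*) [CommRing k] [AddCommGroup X]
    [Module k X] [Coalgebra k X]
    (hcc : ∀ a : X, TensorProduct.comm k X X (Coalgebra.comul a) = Coalgebra.comul a)
    (T : X ⊗[k] (X ⊗[k] X) →ₗ[k] X)
    (hTSD : IsTSD k T) (hTinv : IsInvertibleTSD k T) (hTmor : IsCoalgMor k T)
    (β₁ β₁' : X ⊗[k] (X ⊗[k] X) →ₗ[k] X ⊗[k] (X ⊗[k] X))
    (hβ₁ : ∀ (x y z : X) {n m : ℕ} (y1 y2 : Fin n → X) (z1 z2 : Fin m → X),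
      Rep2 k y y1 y2 → Rep2 k z z1 z2 →
      β₁ (x ⊗ₜ[k] (y ⊗ₜ[k] z)) =
        ∑ i, ∑ j, y1 i ⊗ₜ[k] (z1 j ⊗ₜ[k] T (x ⊗ₜ[k] (y2 i ⊗ₜ[k] z2 j))))
    (hβ₁' : ∀ (y z x : X) {n m : ℕ} (y1 y2 : Fin n → X) (z1 z2 : Fin m → X),
      Rep2 k y y1 y2 → Rep2 k z z1 z2 →
      β₁' (y ⊗ₜ[k] (z ⊗ₜ[k] x)) =
        ∑ i, ∑ j, T (x ⊗ₜ[k] (z2 j ⊗ₜ[k] y2 i)) ⊗ₜ[k] (y1 i ⊗ₜ[k] z1 j)) :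
    β₁' ∘ₗ β₁ = LinearMap.id ∧ β₁ ∘ₗ β₁' = LinearMap.id := by
  constructor
  · refine TensorProduct.ext_threefold' fun x y z ↦ ?_
    obtain ⟨n, y1, y2, hy⟩ := exists_rep2 k y
    obtain ⟨m, z1, z2, hz⟩ := exists_rep2 k z
    choose l a b hab using fun i ↦ exists_rep2 k (y1 i)
    choose r c d hcd using fun j ↦ exists_rep2 k (z1 j)
    have key := hTinv.sum_cancel ((TensorProduct.comm k (X ⊗[k] X) X).toLinearMap ∘ₗ
      (TensorProduct.assoc k X X X).symm.toLinearMap) x hy hz hab hcd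
    simp only [LinearMap.comp_apply, LinearMap.id_apply, hβ₁ x y z _ _ _ _ hy hz, map_sum,
      hβ₁' _ _ _ _ _ _ _ (hab _) (hcd _)]
    simpa using key
  · refine TensorProduct.ext_threefold' fun y z x ↦ ?_
    obtain ⟨n, y1, y2, hy⟩ := exists_rep2 k y
    obtain ⟨m, z1, z2, hz⟩ := exists_rep2 k z
    choose l a b hab using fun i ↦ exists_rep2 k (y1 i)
    choose r c d hcd using fun j ↦ exists_rep2 k (z1 j)
    have key := hTinv.sum_cancel (TensorProduct.leftComm k X X X).toLinearMap x hz hy hcd hab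
    simp only [LinearMap.comp_apply, LinearMap.id_apply, hβ₁' y z x _ _ _ _ hy hz, map_sum,
      hβ₁ _ _ _ _ _ _ _ (hab _) (hcd _)]
    rw [Finset.sum_comm]
    simp only [LinearEquiv.coe_coe, TensorProduct.leftComm_tmul] at key
    rw [← key]
    exact Finset.sum_congr rfl fun j _ ↦ Finset.sum_congr rfl fun i _ ↦ Finset.sum_comm
end

section
/- Let X be a cocommutative involutory Hopf algebra over a commutative ring k. Then the k-linear map β : X^{⊗4} → X^{⊗4} determined by β(x⊗y⊗z⊗w) = z⁽¹⁾ ⊗ w⁽¹⁾ ⊗ x·S(z⁽²⁾)·w⁽²⁾ ⊗ y·S(z⁽³⁾)·w⁽³⁾ is a Yang–Baxter operator: it satisfies (β ⊗ id_{X⊗X}) ∘ (id_{X⊗X} ⊗ β) ∘ (β ⊗ id_{X⊗X}) = (id_{X⊗X} ⊗ β) ∘ (β ⊗ id_{X⊗X}) ∘ (id_{X⊗X} ⊗ β) on X^{⊗6}, and it is bijective, with inverse β'(z⊗w⊗x⊗y) = x·S(w⁽²⁾)·z⁽²⁾ ⊗ y·S(w⁽³⁾)·z⁽³⁾ ⊗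 z⁽¹⁾ ⊗ w⁽¹⁾. -/
open TensorProduct

/-- `β ⊗ id` acting on the first two factors of `V ⊗ (V ⊗ V)`. -/
noncomputable def beta12 {k V : Type*} [CommRing k] [AddCommGroup V] [Module k V]
    (β : V ⊗[k] V →ₗ[k] V ⊗[k] V) : V ⊗[k] (V ⊗[k] V) →ₗ[k] V ⊗[k] (V ⊗[k] V) :=
  (TensorProduct.assoc k V V V).toLinearMap ∘ₗ (TensorProduct.map β LinearMap.id) ∘ₗ
    (TensorProduct.assoc k V V V).symm.toLinearMap

/-- `id ⊗ β` acting on the last two factors of `V ⊗ (V ⊗ V)`. -/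
noncomputable def beta23 {k V : Type*} [CommRing k] [AddCommGroup V] [Module k V]
    (β : V ⊗[k] V →ₗ[k] V ⊗[k] V) : V ⊗[k] (V ⊗[k] V) →ₗ[k] V ⊗[k] (V ⊗[k] V) :=
  LinearMap.lTensor V β

open Coalgebra WithConv

namespace CoalgHom

section Cartesian

variable {k A B C D : Type*} [CommRing k] [AddCommMonoid A] [AddCommMonoid B] [AddCommMonoid C]
  [AddCommMonoid D] [Module k A] [Module k B] [Module k C] [Module k D]
  [Coalgebra k A] [Coalgebra k B] [Coalgebra k C] [Coalgebra k D]

variable (k A B) in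
/-- The projection `a ⊗ b ↦ ε(b) a`. -/
noncomputable def fst : A ⊗[k] B →ₗc[k] A :=
  (Coalgebra.TensorProduct.rid k k A : A ⊗[k] k →ₗc[k] A).comp
    (Coalgebra.TensorProduct.map (CoalgHom.id k A) (counitCoalgHom k B))

variable (k A B) in
/-- The projection `a ⊗ b ↦ ε(a) b`. -/
noncomputable def snd : A ⊗[k] B →ₗc[k] B :=
  (Coalgebra.TensorProduct.lid k B : k ⊗[k] B →ₗc[k] B).comp
    (Coalgebra.TensorProduct.map (counitCoalgHom k A) (CoalgHom.id k B))

@[simp] lemma fst_tmul (a : A) (b : B) : fst k A B (a ⊗ₜ b) = counit (R := k) b • a := rfl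

@[simp] lemma snd_tmul (a : A) (b : B) : snd k A B (a ⊗ₜ b) = counit (R := k) a • b := rfl

/-- The pairing `c ↦ f(c⁽¹⁾) ⊗ g(c⁽²⁾)` of two morphisms out of a cocommutative coalgebra. -/
noncomputable def pair [IsCocomm k C] (f : C →ₗc[k] A) (g : C →ₗc[k] B) : C →ₗc[k] A ⊗[k] B :=
  (Coalgebra.TensorProduct.map f g).comp (comulCoalgHom k C)

lemma pair_apply [IsCocomm k C] (f : C →ₗc[k] A) (g : C →ₗc[k] B) (c : C) :
    pair f g c = TensorProduct.map (f : C →ₗ[k] A) (g : C →ₗ[k] B) (comul c) := rfl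

lemma pair_comp [IsCocomm k C] [IsCocomm k D] (f : C →ₗc[k] A) (g : C →ₗc[k] B)
    (h : D →ₗc[k] C) : (pair f g).comp h = pair (f.comp h) (g.comp h) := by
  ext d
  simp only [comp_apply, pair_apply, ← CoalgHomClass.map_comp_comul_apply, comp_toLinearMap,
    TensorProduct.map_comp, LinearMap.comp_apply]

private lemma sum_counit_right_smul (c : C) :
    ∑ i ∈ (ℛ k c).index, counit (R := k) ((ℛ k c).right i) • (ℛ k c).left i = c := by
  simpa only [map_sum, TensorProduct.rid_tmul, one_smul] using
    congr(TensorProduct.rid k C $(sum_tmul_counit_eq (ℛ k c)))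

@[simp] lemma fst_comp_pair [IsCocomm k C] (f : C →ₗc[k] A) (g : C →ₗc[k] B) :
    (fst k A B).comp (pair f g) = f := by
  ext c
  rw [comp_apply, pair_apply, ← (ℛ k c).eq]
  simpa using congr(f $(sum_counit_right_smul (k := k) c))

@[simp] lemma snd_comp_pair [IsCocomm k C] (f : C →ₗc[k] A) (g : C →ₗc[k] B) :
    (snd k A B).comp (pair f g) = g := by
  ext c
  rw [comp_apply, pair_apply, ← (ℛ k c).eq]
  simpa using congr(g $(sum_counit_smul (ℛ k c)))

lemma pair_fst_snd [IsCocomm k A] [IsCocomm k B] :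
    pair (fst k A B) (snd k A B) = CoalgHom.id k (A ⊗[k] B) := by
  apply coe_linearMap_injective
  ext a b
  simp [pair_apply, ← (ℛ k a).eq, ← (ℛ k b).eq, TensorProduct.sum_tmul, TensorProduct.tmul_sum]
  conv_rhs => rw [← sum_counit_right_smul (k := k) a, ← sum_counit_smul (ℛ k b)]
  simp only [TensorProduct.sum_tmul, TensorProduct.tmul_sum, ← TensorProduct.smul_tmul',
    TensorProduct.tmul_smul]
  exact Finset.sum_congr rfl fun i _ ↦ by
    rw [Finset.smul_sum]
    exact Finset.sum_congr rfl fun j _ ↦ smul_comm _ _ _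

lemma pair_fst_comp_snd_comp [IsCocomm k C] (f : C →ₗc[k] A ⊗[k] B) [IsCocomm k A]
    [IsCocomm k B] : pair ((fst k A B).comp f) ((snd k A B).comp f) = f := by
  rw [← pair_comp, pair_fst_snd, id_comp]

lemma prod_ext [IsCocomm k A] [IsCocomm k B] [IsCocomm k C] {f g : C →ₗc[k] A ⊗[k] B}
    (h₁ : (fst k A B).comp f = (fst k A B).comp g)
    (h₂ : (snd k A B).comp f = (snd k A B).comp g) : f = g := by
  rw [← pair_fst_comp_snd_comp f, h₁, h₂, pair_fst_comp_snd_comp]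

lemma map_comp_pair {E : Type*} [AddCommMonoid E] [Module k E] [Coalgebra k E] [IsCocomm k E]
    (f : A →ₗc[k] C) (g : B →ₗc[k] D) (u : E →ₗc[k] A) (v : E →ₗc[k] B) :
    (Coalgebra.TensorProduct.map f g).comp (pair u v) = pair (f.comp u) (g.comp v) := by
  ext e
  simp only [comp_apply, pair_apply, comp_toLinearMap, TensorProduct.map_comp,
    LinearMap.comp_apply]
  rfl

lemma assoc_comp_pair [IsCocomm k A] [IsCocomm k B] [IsCocomm k C] [IsCocomm k D]
    (u : D →ₗc[k] A) (v : D →ₗc[k] B) (w : D →ₗc[k] C) :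
    (Coalgebra.TensorProduct.assoc k k A B C : _ →ₗc[k] _).comp (pair (pair u v) w) =
      pair u (pair v w) := by
  have h : (Coalgebra.TensorProduct.assoc k k A B C : _ →ₗc[k] _) =
      pair ((fst k A B).comp (fst k _ C)) (pair ((snd k A B).comp (fst k _ C)) (snd k _ C)) := by
    refine prod_ext ?_ (prod_ext ?_ ?_) <;> simp only [fst_comp_pair, snd_comp_pair] <;>
      apply coe_linearMap_injective <;> ext a b c <;> simp [smul_smul, mul_comm]
  simp only [h, pair_comp, comp_assoc, fst_comp_pair, snd_comp_pair]

variable (k A B) in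
/-- The swap of the two tensor factors. -/
noncomputable def swap [IsCocomm k A] [IsCocomm k B] : A ⊗[k] B →ₗc[k] B ⊗[k] A :=
  pair (snd k A B) (fst k A B)

lemma swap_tmul [IsCocomm k A] [IsCocomm k B] (a : A) (b : B) :
    swap k A B (a ⊗ₜ b) = b ⊗ₜ a := by
  have h := congr(TensorProduct.comm k A B ($(pair_fst_snd (k := k) (A := A) (B := B)) (a ⊗ₜ b)))
  rw [swap, pair_apply, ← comm_comul k (a ⊗ₜ[k] b), TensorProduct.map_comm]
  exact h

lemma beta23_pair {V : Type*} [AddCommGroup V] [Module k V] [Coalgebra k V] [IsCocomm k V]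
    [IsCocomm k C] {e : V ⊗[k] V →ₗc[k] V ⊗[k] V} {v w v' w' : C →ₗc[k] V}
    (h : e.comp (pair v w) = pair v' w') (u : C →ₗc[k] V) (c : C) :
    beta23 e.toLinearMap (pair u (pair v w) c) = pair u (pair v' w') c := by
  have h₁ := map_comp_pair (CoalgHom.id k V) e u (pair v w)
  rw [h, id_comp] at h₁
  exact congr($h₁ c)

lemma beta12_pair {V : Type*} [AddCommGroup V] [Module k V] [Coalgebra k V] [IsCocomm k V]
    [IsCocomm k C] {e : V ⊗[k] V →ₗc[k] V ⊗[k] V} {u v u' v' : C →ₗc[k] V}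
    (h : e.comp (pair u v) = pair u' v') (w : C →ₗc[k] V) (c : C) :
    beta12 e.toLinearMap (pair u (pair v w) c) = pair u' (pair v' w) c := by
  have h₁ := map_comp_pair e (CoalgHom.id k V) (pair u v) w
  rw [h, id_comp] at h₁
  have h₂ (s : (V ⊗[k] V) ⊗[k] V) : beta12 e.toLinearMap (TensorProduct.assoc k V V V s) =
      TensorProduct.assoc k V V V (TensorProduct.map e.toLinearMap LinearMap.id s) := by
    simp [beta12]
  rw [← assoc_comp_pair, ← assoc_comp_pair, ← h₁]
  exact h₂ _

/-- A coalgebra morphism given on points by `(u, v) ↦ (v, m u v)` with `m` self-distributive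
satisfies the Yang–Baxter equation. -/
lemma yangBaxter_of_selfDistrib {V : Type*} [AddCommGroup V] [Module k V] [Coalgebra k V]
    [IsCocomm k V] {e : V ⊗[k] V →ₗc[k] V ⊗[k] V}
    {m : (V ⊗[k] (V ⊗[k] V) →ₗc[k] V) → (V ⊗[k] (V ⊗[k] V) →ₗc[k] V) →
      (V ⊗[k] (V ⊗[k] V) →ₗc[k] V)}
    (he : ∀ u v, e.comp (pair u v) = pair v (m u v))
    (hm : ∀ u v w, m (m u w) (m v w) = m (m u v) w) :
    beta12 e.toLinearMap ∘ₗ beta23 e.toLinearMap ∘ₗ beta12 e.toLinearMap =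
      beta23 e.toLinearMap ∘ₗ beta12 e.toLinearMap ∘ₗ beta23 e.toLinearMap := by
  refine LinearMap.ext fun t ↦ ?_
  have ht : pair (fst k V (V ⊗[k] V))
      (pair ((fst k V V).comp (snd k _ _)) ((snd k V V).comp (snd k _ _))) t = t := by
    rw [pair_fst_comp_snd_comp, pair_fst_snd, CoalgHom.id_apply]
  rw [← ht]
  simp only [LinearMap.comp_apply, beta12_pair (he _ _), beta23_pair (he _ _), hm]

end Cartesian

section Heap

variable {k C D X : Type*} [CommRing k] [AddCommMonoid C] [AddCommMonoid D] [Module k C]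
  [Module k D] [Coalgebra k C] [Coalgebra k D]
  [Ring X] [HopfAlgebra k X]

open HopfAlgebra in
variable (k X) in
/-- The antipode of a cocommutative Hopf algebra as a coalgebra morphism. -/
noncomputable def antipodeHom [IsCocomm k X] : X →ₗc[k] X where
  toLinearMap := antipode k
  counit_comp := by ext; simp
  map_comp_comul := by
    apply WithConv.toConv_injective
    refine left_inv_eq_right_inv ?_ LinearMap.comul_right_inv
    have h := LinearMap.convMul_comp_coalgHom_distrib
      (toConv (TensorProduct.map (antipode k (A := X)) (antipode k (A := X))))
      (toConv (TensorProduct.map LinearMap.id LinearMap.id)) (comulCoalgHom k X)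
    have h2 := TensorProduct.map_convMul_map (f := toConv (antipode k (A := X)))
      (h := toConv LinearMap.id) (g := toConv (antipode k (A := X))) (k := toConv LinearMap.id)
    rw [LinearMap.antipode_mul_id] at h2
    rw [h2] at h
    apply WithConv.ofConv_injective
    refine Eq.trans ?_ (h.symm.trans ?_)
    · simp
      rfl
    · ext c
      have h3 := congr(counit (R := k) $(sum_counit_smul (ℛ k c)))
      simp only [map_sum, map_smul, smul_eq_mul] at h3
      simp only [LinearMap.convOne_def, LinearMap.comp_apply, ofConv_toConv]
      change TensorProduct.map _ _ (comul c) = _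
      rw [← (ℛ k c).eq]
      simp [← h3, Algebra.algebraMap_eq_smul_one, Algebra.TensorProduct.one_def,
        TensorProduct.smul_tmul', TensorProduct.tmul_smul, smul_smul, mul_comm]

@[simp] lemma antipodeHom_apply [IsCocomm k X] (x : X) :
    antipodeHom k X x = HopfAlgebra.antipode k x := rfl

noncomputable instance : One (WithConv (C →ₗc[k] X)) where
  one := toConv ((Bialgebra.unitBialgHom k X).toCoalgHom.comp (counitCoalgHom k C))

lemma toLinearMap_convOne :
    toConv ((1 : WithConv (C →ₗc[k] X)).ofConv : C →ₗ[k] X) = 1 := rfl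

lemma toConv_toLinearMap_injective : Function.Injective
    fun f : WithConv (C →ₗc[k] X) ↦ toConv (f.ofConv : C →ₗ[k] X) :=
  toConv_injective.comp (coe_linearMap_injective.comp ofConv_injective)

variable [IsCocomm k C] [IsCocomm k D]

noncomputable instance : Mul (WithConv (C →ₗc[k] X)) where
  mul f g := toConv ((Bialgebra.mulCoalgHom k X).comp (pair f.ofConv g.ofConv))

noncomputable instance [IsCocomm k X] : Inv (WithConv (C →ₗc[k] X)) where
  inv f := toConv ((antipodeHom k X).comp f.ofConv)

lemma convMul_def (f g : WithConv (C →ₗc[k] X)) :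
    f * g = toConv ((Bialgebra.mulCoalgHom k X).comp (pair f.ofConv g.ofConv)) := rfl

lemma toLinearMap_convMul (f g : WithConv (C →ₗc[k] X)) :
    toConv ((f * g).ofConv : C →ₗ[k] X) =
      toConv (f.ofConv : C →ₗ[k] X) * toConv (g.ofConv : C →ₗ[k] X) := rfl

noncomputable instance [IsCocomm k X] : Group (WithConv (C →ₗc[k] X)) :=
  .ofLeftAxioms
    (fun f g h ↦ toConv_toLinearMap_injective <| by simp only [toLinearMap_convMul, mul_assoc])
    (fun f ↦ toConv_toLinearMap_injective <| by
      simp only [toLinearMap_convMul, toLinearMap_convOne, one_mul])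
    (fun f ↦ toConv_toLinearMap_injective <| by
      have h := LinearMap.convMul_comp_coalgHom_distrib
        (toConv (HopfAlgebra.antipode k (A := X))) (toConv LinearMap.id) f.ofConv
      rw [LinearMap.antipode_mul_id] at h
      simp only [toLinearMap_convMul, toLinearMap_convOne]
      refine (congrArg toConv h.symm).trans ?_
      ext c
      simp)

/-- The heap operation `f g⁻¹ h` of the convolution group of coalgebra morphisms. -/
noncomputable def heap [IsCocomm k X] (f g h : C →ₗc[k] X) : C →ₗc[k] X :=
  (toConv f * (toConv g)⁻¹ * toConv h).ofConv

lemma convMul_comp (f g : WithConv (C →ₗc[k] X)) (e : D →ₗc[k] C) :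
    (f * g).ofConv.comp e = (toConv (f.ofConv.comp e) * toConv (g.ofConv.comp e)).ofConv := by
  simp only [convMul_def, ofConv_toConv, comp_assoc, pair_comp]

lemma heap_heap_self [IsCocomm k X] (f g h : C →ₗc[k] X) : heap (heap f g h) h g = f := by
  simp [heap]

lemma heap_heap_distrib [IsCocomm k X] (a c d u v : C →ₗc[k] X) :
    heap (heap a u v) (heap c u v) (heap d u v) = heap (heap a c d) u v := by
  simp only [heap, toConv_ofConv]
  group

lemma comp_convMul {Y : Type*} [Ring Y] [HopfAlgebra k Y] (e : X →ₗc[k] Y)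
    (he : ∀ a b, e (a * b) = e a * e b) (f g : WithConv (C →ₗc[k] X)) :
    e.comp (f * g).ofConv = (toConv (e.comp f.ofConv) * toConv (e.comp g.ofConv)).ofConv := by
  ext c
  simp only [convMul_def, ofConv_toConv, comp_apply, pair_apply]
  induction comul (R := k) c with
  | zero => simp
  | add a b ha hb => simp only [map_add, ha, hb]
  | tmul a b => simp [he]

lemma map_comul_tmul {V : Type*} [AddCommMonoid V] [Module k V]
    (G : (X ⊗[k] X) ⊗[k] (X ⊗[k] X) →ₗ[k] V) (z w : X) :
    TensorProduct.map LinearMap.id (G ∘ₗ TensorProduct.map comul comul)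
        (comul (R := k) (z ⊗ₜ[k] w)) =
      TensorProduct.map LinearMap.id G
        (TensorProduct.tensorTensorTensorComm k _ _ _ _ (delta3 k z ⊗ₜ delta3 k w)) := by
  rw [TensorProduct.comul_tmul, delta3, LinearMap.comp_apply, LinearMap.comp_apply]
  induction comul (R := k) z with
  | zero => simp
  | add a b ha hb => simp only [map_add, TensorProduct.add_tmul, ha, hb]
  | tmul z₁ z₂ =>
    induction comul (R := k) w with
    | zero => simp
    | add a b ha hb => simp only [map_add, TensorProduct.tmul_add, ha, hb]
    | tmul w₁ w₂ => simp

end Heap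

section Braiding

variable {k C D X : Type*} [CommRing k] [AddCommMonoid C] [AddCommMonoid D] [Module k C]
  [Module k D] [Coalgebra k C] [Coalgebra k D] [IsCocomm k C] [IsCocomm k D]
  [Ring X] [HopfAlgebra k X] [IsCocomm k X]

variable (k X) in
/-- The morphism `z ⊗ w ↦ S(z) w`. -/
noncomputable def leftDiv : X ⊗[k] X →ₗc[k] X :=
  ((toConv (fst k X X))⁻¹ * toConv (snd k X X)).ofConv

variable (k X) in
/-- The morphism `z ⊗ w ↦ S(z⁽¹⁾) w⁽¹⁾ ⊗ S(z⁽²⁾) w⁽²⁾`. -/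
noncomputable def leftDiv₂ : X ⊗[k] X →ₗc[k] X ⊗[k] X :=
  pair (leftDiv k X) (leftDiv k X)

/-- The translation of `u` by `v`, given on points by
`(x ⊗ y, z ⊗ w) ↦ x S(z⁽¹⁾) w⁽¹⁾ ⊗ y S(z⁽²⁾) w⁽²⁾`. -/
noncomputable def act (u v : C →ₗc[k] X ⊗[k] X) : C →ₗc[k] X ⊗[k] X :=
  (toConv u * toConv ((leftDiv₂ k X).comp v)).ofConv

lemma leftDiv_comp (v : C →ₗc[k] X ⊗[k] X) : (leftDiv k X).comp v =
    ((toConv ((fst k X X).comp v))⁻¹ * toConv ((snd k X X).comp v)).ofConv := by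
  rw [leftDiv, convMul_comp]
  rfl

lemma fst_comp_act (u v : C →ₗc[k] X ⊗[k] X) : (fst k X X).comp (act u v) =
    heap ((fst k X X).comp u) ((fst k X X).comp v) ((snd k X X).comp v) := by
  rw [act, comp_convMul, heap, mul_assoc]
  · simp only [leftDiv₂, pair_comp, fst_comp_pair, leftDiv_comp, toConv_ofConv]
  · intro a b
    induction a with
    | zero => simp
    | add a₁ a₂ h₁ h₂ => simp only [add_mul, map_add, h₁, h₂]
    | tmul x y =>
      induction b with
      | zero => simp
      | add b₁ b₂ h₁ h₂ => simp only [mul_add, map_add, h₁, h₂]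
      | tmul z w => simp [smul_smul, mul_comm]

lemma snd_comp_act (u v : C →ₗc[k] X ⊗[k] X) : (snd k X X).comp (act u v) =
    heap ((snd k X X).comp u) ((fst k X X).comp v) ((snd k X X).comp v) := by
  rw [act, comp_convMul, heap, mul_assoc]
  · simp only [leftDiv₂, pair_comp, snd_comp_pair, leftDiv_comp, toConv_ofConv]
  · intro a b
    induction a with
    | zero => simp
    | add a₁ a₂ h₁ h₂ => simp only [add_mul, map_add, h₁, h₂]
    | tmul x y =>
      induction b with
      | zero => simp
      | add b₁ b₂ h₁ h₂ => simp only [mul_add, map_add, h₁, h₂]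
      | tmul z w => simp [smul_smul, mul_comm]

lemma act_comp (u v : C →ₗc[k] X ⊗[k] X) (e : D →ₗc[k] C) :
    (act u v).comp e = act (u.comp e) (v.comp e) := by
  simp only [act, convMul_comp, comp_assoc]

lemma act_act_distrib (u v w : C →ₗc[k] X ⊗[k] X) :
    act (act u w) (act v w) = act (act u v) w := by
  apply prod_ext <;> simp only [fst_comp_act, snd_comp_act, heap_heap_distrib]

lemma act_act_swap (u v : C →ₗc[k] X ⊗[k] X) :
    act (act u v) ((swap k X X).comp v) = u := by
  apply prod_ext <;>
    simp only [fst_comp_act, snd_comp_act, swap, ← comp_assoc, fst_comp_pair, snd_comp_pair,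
      heap_heap_self]

lemma act_swap_act (u v : C →ₗc[k] X ⊗[k] X) :
    act (act u ((swap k X X).comp v)) v = u := by
  apply prod_ext <;>
    simp only [fst_comp_act, snd_comp_act, swap, ← comp_assoc, fst_comp_pair, snd_comp_pair,
      heap_heap_self]

variable (k X) in
/-- The quantum heap braiding, given on points by `(u, v) ↦ (v, act u v)`. -/
noncomputable def braid : (X ⊗[k] X) ⊗[k] (X ⊗[k] X) →ₗc[k] (X ⊗[k] X) ⊗[k] (X ⊗[k] X) :=
  pair (snd k _ _) (act (fst k _ _) (snd k _ _))

variable (k X) in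
/-- The inverse braiding, given on points by `(v, u) ↦ (act u (swap v), v)`. -/
noncomputable def unbraid : (X ⊗[k] X) ⊗[k] (X ⊗[k] X) →ₗc[k] (X ⊗[k] X) ⊗[k] (X ⊗[k] X) :=
  pair (act (snd k _ _) ((swap k X X).comp (fst k _ _))) (fst k _ _)

lemma braid_comp_pair (u v : C →ₗc[k] X ⊗[k] X) :
    (braid k X).comp (pair u v) = pair v (act u v) := by
  simp only [braid, pair_comp, act_comp, fst_comp_pair, snd_comp_pair]

lemma unbraid_comp_pair (u v : C →ₗc[k] X ⊗[k] X) :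
    (unbraid k X).comp (pair v u) = pair (act u ((swap k X X).comp v)) v := by
  simp only [unbraid, pair_comp, act_comp, comp_assoc, fst_comp_pair, snd_comp_pair]

lemma braid_comp_unbraid : (braid k X).comp (unbraid k X) = CoalgHom.id k _ := by
  rw [unbraid, braid_comp_pair, act_swap_act, pair_fst_snd]

lemma unbraid_comp_braid : (unbraid k X).comp (braid k X) = CoalgHom.id k _ := by
  rw [braid, unbraid_comp_pair, act_act_swap, pair_fst_snd]

open HopfAlgebra

lemma leftDiv_tmul (z w : X) : leftDiv k X (z ⊗ₜ w) = antipode k z * w := by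
  have h : leftDiv k X = (Bialgebra.mulCoalgHom k X).comp
      (Coalgebra.TensorProduct.map (antipodeHom k X) (CoalgHom.id k X)) := by
    rw [← comp_id (Coalgebra.TensorProduct.map _ _), ← pair_fst_snd, map_comp_pair]
    rfl
  simp [h]

lemma leftDiv₂_tmul (z w : X) : leftDiv₂ k X (z ⊗ₜ w) =
    TensorProduct.map (antipode k) (antipode k) (comul z) * comul (R := k) w := by
  rw [leftDiv₂, pair_apply, TensorProduct.comul_tmul]
  induction comul (R := k) z with
  | zero => simp
  | add a b ha hb => simp only [map_add, TensorProduct.add_tmul, add_mul, ha, hb]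
  | tmul z₁ z₂ =>
    induction comul (R := k) w with
    | zero => simp
    | add a b ha hb => simp only [map_add, TensorProduct.tmul_add, mul_add, ha, hb]
    | tmul w₁ w₂ => simp [leftDiv_tmul]

lemma act_fst_comp_snd_tmul (e : D →ₗc[k] X ⊗[k] X) (s : X ⊗[k] X) (t : D) :
    act (fst k _ _) (e.comp (snd k _ _)) (s ⊗ₜ t) = s * leftDiv₂ k X (e t) := by
  have h : act (fst k _ _) (e.comp (snd k _ _)) = (Bialgebra.mulCoalgHom k (X ⊗[k] X)).comp
      (Coalgebra.TensorProduct.map (CoalgHom.id k _) ((leftDiv₂ k X).comp e)) := by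
    rw [← comp_id (Coalgebra.TensorProduct.map _ _), ← pair_fst_snd (A := X ⊗[k] X) (B := D),
      map_comp_pair]
    rfl
  simp [h]

lemma pair_snd_act_tmul (e : D →ₗc[k] X ⊗[k] X) (s : X ⊗[k] X) (t : D) :
    pair (snd k _ _) (act (fst k _ _) (e.comp (snd k _ _))) (s ⊗ₜ t) =
      TensorProduct.map LinearMap.id
        (LinearMap.mulLeft k s ∘ₗ ((leftDiv₂ k X).comp e : D →ₗ[k] X ⊗[k] X)) (comul t) := by
  conv_rhs => rw [← sum_counit_smul (ℛ k s)]
  simp only [pair_apply, TensorProduct.comul_tmul, ← (ℛ k s).eq, ← (ℛ k t).eq,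
    TensorProduct.sum_tmul, TensorProduct.tmul_sum]
  simp [act_fst_comp_snd_tmul, Finset.sum_mul, TensorProduct.tmul_sum, TensorProduct.smul_tmul]

lemma braid_tmul (x y z w : X) {n m : ℕ} {z₁ z₂ z₃ : Fin n → X} {w₁ w₂ w₃ : Fin m → X}
    (hz : Rep3 k z z₁ z₂ z₃) (hw : Rep3 k w w₁ w₂ w₃) :
    braid k X ((x ⊗ₜ y) ⊗ₜ (z ⊗ₜ w)) = ∑ i, ∑ j, (z₁ i ⊗ₜ[k] w₁ j) ⊗ₜ[k]
      ((x * antipode k (z₂ i) * w₂ j) ⊗ₜ[k] (y * antipode k (z₃ i) * w₃ j)) := by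
  have h : LinearMap.mulLeft k (x ⊗ₜ[k] y) ∘ₗ
      ((leftDiv₂ k X).comp (CoalgHom.id k _) : X ⊗[k] X →ₗ[k] X ⊗[k] X) =
      (LinearMap.mulLeft k (x ⊗ₜ[k] y) ∘ₗ LinearMap.mul' k (X ⊗[k] X) ∘ₗ
        TensorProduct.map (TensorProduct.map (antipode k) (antipode k)) LinearMap.id) ∘ₗ
        TensorProduct.map comul comul := by
    ext a b
    simp [leftDiv₂_tmul]
  have h' := pair_snd_act_tmul (CoalgHom.id k (X ⊗[k] X)) (x ⊗ₜ y) (z ⊗ₜ w)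
  rw [h, map_comul_tmul, hz, hw, id_comp] at h'
  rw [braid, h']
  simp [TensorProduct.sum_tmul, TensorProduct.tmul_sum, mul_assoc]
  exact Finset.sum_comm

lemma unbraid_eq : unbraid k X = (swap k _ _).comp
    ((pair (snd k _ _) (act (fst k _ _) ((swap k X X).comp (snd k _ _)))).comp
      (swap k _ _)) := by
  simp only [unbraid, swap, pair_comp, act_comp, comp_assoc, fst_comp_pair, snd_comp_pair]

lemma unbraid_tmul (z w x y : X) {n m : ℕ} {z₁ z₂ z₃ : Fin n → X} {w₁ w₂ w₃ : Fin m → X}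
    (hz : Rep3 k z z₁ z₂ z₃) (hw : Rep3 k w w₁ w₂ w₃) :
    unbraid k X ((z ⊗ₜ w) ⊗ₜ (x ⊗ₜ y)) = ∑ i, ∑ j,
      ((x * antipode k (w₂ j) * z₂ i) ⊗ₜ[k] (y * antipode k (w₃ j) * z₃ i)) ⊗ₜ[k]
        (z₁ i ⊗ₜ[k] w₁ j) := by
  have h : LinearMap.mulLeft k (x ⊗ₜ[k] y) ∘ₗ
      ((leftDiv₂ k X).comp (swap k X X) : X ⊗[k] X →ₗ[k] X ⊗[k] X) =
      (LinearMap.mulLeft k (x ⊗ₜ[k] y) ∘ₗ LinearMap.mul' k (X ⊗[k] X) ∘ₗ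
        TensorProduct.map (TensorProduct.map (antipode k) (antipode k)) LinearMap.id ∘ₗ
        (TensorProduct.comm k _ _).toLinearMap) ∘ₗ TensorProduct.map comul comul := by
    ext a b
    simp [leftDiv₂_tmul, swap_tmul]
  have h' := pair_snd_act_tmul (swap k X X) (x ⊗ₜ y) (z ⊗ₜ w)
  rw [h, map_comul_tmul, hz, hw] at h'
  rw [unbraid_eq, comp_apply, comp_apply, swap_tmul, h']
  simp [TensorProduct.sum_tmul, TensorProduct.tmul_sum, mul_assoc, swap_tmul]
  exact Finset.sum_comm

end Braiding

end CoalgHom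

lemma exists_rep3 (k : Type*) {X : Type*} [CommRing k] [AddCommMonoid X] [Module k X]
    [Coalgebra k X] (x : X) : ∃ (n : ℕ) (x₁ x₂ x₃ : Fin n → X), Rep3 k x x₁ x₂ x₃ := by
  have key (t : X ⊗[k] (X ⊗[k] X)) : ∃ l : List (X × X × X),
      t = (l.map fun p ↦ p.1 ⊗ₜ[k] (p.2.1 ⊗ₜ[k] p.2.2)).sum := by
    induction t with
    | zero => exact ⟨[], rfl⟩
    | add a b ha hb =>
      obtain ⟨l, rfl⟩ := ha
      obtain ⟨l', rfl⟩ := hb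
      exact ⟨l ++ l', by simp⟩
    | tmul a s =>
      induction s with
      | zero => exact ⟨[], by simp⟩
      | add s s' hs hs' =>
        obtain ⟨l, hl⟩ := hs
        obtain ⟨l', hl'⟩ := hs'
        exact ⟨l ++ l', by simp [TensorProduct.tmul_add, hl, hl']⟩
      | tmul b c => exact ⟨[(a, b, c)], by simp⟩
  obtain ⟨l, hl⟩ := key (delta3 k x)
  refine ⟨l.length, fun i ↦ l[i].1, fun i ↦ l[i].2.1, fun i ↦ l[i].2.2, ?_⟩
  rw [Rep3, hl, ← Fin.sum_univ_fun_getElem]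
  rfl

/-- for a cocommutative involutory Hopf algebra, the map
`β(x⊗y⊗z⊗w) = z⁽¹⁾ ⊗ w⁽¹⁾ ⊗ x·S(z⁽²⁾)·w⁽²⁾ ⊗ y·S(z⁽³⁾)·w⁽³⁾` is a Yang–Baxter operator,
bijective with the indicated inverse. -/
theorem quantum_heap_braiding_YB_operator (k X : Type*) [CommRing k] [Ring X] [HopfAlgebra k X]
    (S : X →ₗ[k] X) (hS : S = HopfAlgebra.antipode (R := k))
    (hinv : ∀ a : X, S (S a) = a)
    (hcc : ∀ a : X, TensorProduct.comm k X X (Coalgebra.comul a) = Coalgebra.comul a)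
    (β β' : (X ⊗[k] X) ⊗[k] (X ⊗[k] X) →ₗ[k] (X ⊗[k] X) ⊗[k] (X ⊗[k] X))
    (hβ : ∀ (x y z w : X) {n m : ℕ} (z1 z2 z3 : Fin n → X) (w1 w2 w3 : Fin m → X),
      Rep3 k z z1 z2 z3 → Rep3 k w w1 w2 w3 →
      β ((x ⊗ₜ[k] y) ⊗ₜ[k] (z ⊗ₜ[k] w)) =
        ∑ i, ∑ j, (z1 i ⊗ₜ[k] w1 j) ⊗ₜ[k]
          ((x * S (z2 i) * w2 j) ⊗ₜ[k] (y * S (z3 i) * w3 j)))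
    (hβ' : ∀ (z w x y : X) {n m : ℕ} (z1 z2 z3 : Fin n → X) (w1 w2 w3 : Fin m → X),
      Rep3 k z z1 z2 z3 → Rep3 k w w1 w2 w3 →
      β' ((z ⊗ₜ[k] w) ⊗ₜ[k] (x ⊗ₜ[k] y)) =
        ∑ i, ∑ j, ((x * S (w2 j) * z2 i) ⊗ₜ[k] (y * S (w3 j) * z3 i)) ⊗ₜ[k]
          (z1 i ⊗ₜ[k] w1 j)) :
    (beta12 β ∘ₗ beta23 β ∘ₗ beta12 β = beta23 β ∘ₗ beta12 β ∘ₗ beta23 β) ∧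
    Function.Bijective β ∧ β ∘ₗ β' = LinearMap.id ∧ β' ∘ₗ β = LinearMap.id := by
  subst hS
  have : IsCocomm k X := ⟨LinearMap.ext hcc⟩
  have hβ_eq : β = CoalgHom.braid k X := by
    refine TensorProduct.ext (TensorProduct.ext' fun x y ↦ TensorProduct.ext' fun z w ↦ ?_)
    obtain ⟨n, z₁, z₂, z₃, hz⟩ := exists_rep3 k z
    obtain ⟨m, w₁, w₂, w₃, hw⟩ := exists_rep3 k w
    exact (hβ x y z w z₁ z₂ z₃ w₁ w₂ w₃ hz hw).trans (CoalgHom.braid_tmul x y z w hz hw).symm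
  have hβ'_eq : β' = CoalgHom.unbraid k X := by
    refine TensorProduct.ext (TensorProduct.ext' fun z w ↦ TensorProduct.ext' fun x y ↦ ?_)
    obtain ⟨n, z₁, z₂, z₃, hz⟩ := exists_rep3 k z
    obtain ⟨m, w₁, w₂, w₃, hw⟩ := exists_rep3 k w
    exact (hβ' z w x y z₁ z₂ z₃ w₁ w₂ w₃ hz hw).trans (CoalgHom.unbraid_tmul z w x y hz hw).symm
  have h₁ : β ∘ₗ β' = LinearMap.id := by
    rw [hβ_eq, hβ'_eq]
    exact congrArg CoalgHom.toLinearMap CoalgHom.braid_comp_unbraid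
  have h₂ : β' ∘ₗ β = LinearMap.id := by
    rw [hβ_eq, hβ'_eq]
    exact congrArg CoalgHom.toLinearMap CoalgHom.unbraid_comp_braid
  refine ⟨?_, Function.bijective_iff_has_inverse.2
    ⟨β', LinearMap.congr_fun h₂, LinearMap.congr_fun h₁⟩, h₁, h₂⟩
  rw [hβ_eq]
  exact CoalgHom.yangBaxter_of_selfDistrib CoalgHom.braid_comp_pair CoalgHom.act_act_distrib
end

section
/- Let X be a cocommutative involutory Hopf algebra over a commutative ring k, let λ : X → k be a two-sided integral functional, and define ∪ : X⊗X → k by ∪(a⊗b) = λ(a·S(b)) and T(x⊗y⊗z) = x·S(y)·z. Then the passcup property holds: for all x, y, u, v ∈ X, u⁽¹⁾ ⊗ v⁽¹⁾ · ∪( T(x⊗u⁽²⁾⊗v⁽²⁾) ⊗ y ) = ∪( x ⊗ T(y⊗v⁽²⁾⊗u⁽²⁾) ) · u⁽¹⁾ ⊗ v⁽¹⁾, as an identity of k-linear maps X^{⊗4} → X^{⊗2} (explicitly, u⁽¹⁾ ⊗ v⁽¹⁾ · λ( x·S(u⁽²⁾)·v⁽²⁾·S(y) ) = λ( x·S( y·S(v⁽²⁾)·u⁽²⁾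 ) ) · u⁽¹⁾ ⊗ v⁽¹⁾). -/
open TensorProduct

/-- `lam` is a two-sided integral functional:
`x⁽¹⁾·λ(x⁽²⁾) = λ(x)·1` and `λ(x⁽¹⁾)·x⁽²⁾ = λ(x)·1`. -/
def IsIntegralFunctional (k : Type*) {X : Type*} [CommRing k] [Ring X] [HopfAlgebra k X]
    (lam : X →ₗ[k] k) : Prop :=
  ∀ (x : X) {n : ℕ} (x1 x2 : Fin n → X), Rep2 k x x1 x2 →
    (∑ i, lam (x2 i) • x1 i = lam x • (1 : X)) ∧ (∑ i, lam (x1 i) • x2 i = lam x • (1 : X))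

/-- the cup `∪(a⊗b) = λ(a·S(b))` satisfies the passcup property with respect to
the quantum heap operation `T(x⊗y⊗z) = x·S(y)·z`:
`u⁽¹⁾ ⊗ v⁽¹⁾ · λ(x·S(u⁽²⁾)·v⁽²⁾·S(y)) = λ(x·S(y·S(v⁽²⁾)·u⁽²⁾)) · u⁽¹⁾ ⊗ v⁽¹⁾`. -/
theorem passcup (k X : Type*) [CommRing k] [Ring X] [HopfAlgebra k X]
    (S : X →ₗ[k] X) (hS : S = HopfAlgebra.antipode (R := k))
    (hinv : ∀ a : X, S (S a) = a)
    (hcc : ∀ a : X, TensorProduct.comm k X X (Coalgebra.comul a) = Coalgebra.comul a)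
    (lam : X →ₗ[k] k) (hlam : IsIntegralFunctional k lam)
    (x y u v : X) {n m : ℕ} (u1 u2 : Fin n → X) (v1 v2 : Fin m → X)
    (hu : Rep2 k u u1 u2) (hv : Rep2 k v v1 v2) :
    ∑ i, ∑ j, lam (x * S (u2 i) * v2 j * S y) • (u1 i ⊗ₜ[k] v1 j) =
      ∑ i, ∑ j, lam (x * S (y * S (v2 j) * u2 i)) • (u1 i ⊗ₜ[k] v1 j) := by
  have hS_mul (a b : X) : S (a * b) = S b * S a := by
    rw [hS, HopfAlgebra.antipode_mul_antidistrib]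
  simp only [hS_mul, hinv, mul_assoc]
end

section
/- Let X be a commutative and cocommutative Hopf algebra over a commutative ring k with S ∘ S = id, let γ ∈ X be a two-sided cointegral, and define ∩ : k → X⊗X by ∩(1) = Δ(γ). Let β : X^{⊗4} → X^{⊗4} be the braiding β(x⊗y⊗z⊗w) = z⁽¹⁾ ⊗ w⁽¹⁾ ⊗ x·S(z⁽²⁾)·w⁽²⁾ ⊗ y·S(z⁽³⁾)·w⁽³⁾. Then the cap commutes with the braiding: β ∘ (∩ ⊗ id_{X⊗X}) = id_{X⊗X} ⊗ ∩ and β ∘ (id_{X⊗X} ⊗ ∩) = ∩ ⊗ id_{X⊗X}, as k-linear maps X^{⊗2} → X^{⊗4} (identifying k⊗M ≅ M ≅ M⊗k). Explicitly, for all x, y ∈ X: β(γ⁽¹⁾ ⊗ γ⁽²⁾ ⊗ x ⊗ y) = x ⊗ y ⊗ γ⁽¹⁾ ⊗ γ⁽²⁾ and β(x ⊗ y ⊗ γ⁽¹⁾ ⊗ γ⁽²⁾) = γ⁽¹⁾ ⊗ γ⁽²⁾ ⊗ x ⊗ y. -/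
open TensorProduct

/-- `γ` is a two-sided cointegral: `x·γ = ε(x)·γ` and `γ·x = ε(x)·γ`. -/
def IsCointegral (k : Type*) {X : Type*} [CommRing k] [Ring X] [HopfAlgebra k X]
    (γ : X) : Prop :=
  ∀ x : X, x * γ = Coalgebra.counit (R := k) x • γ ∧ γ * x = Coalgebra.counit (R := k) x • γ

open Coalgebra WithConv

section Convolution

variable {k X A : Type*} [CommRing k] [CommRing X] [CommRing A] [Algebra k A]

lemma exists_rep3_s9 [Bialgebra k X] (x : X) :
    ∃ (n : ℕ) (x1 x2 x3 : Fin n → X), Rep3 k x x1 x2 x3 := by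
  suffices ∀ t : X ⊗[k] (X ⊗[k] X), ∃ (n : ℕ) (x1 x2 x3 : Fin n → X),
      t = ∑ i, x1 i ⊗ₜ[k] (x2 i ⊗ₜ[k] x3 i) from this _
  intro t
  induction t with
  | zero => exact ⟨0, Fin.elim0, Fin.elim0, Fin.elim0, by simp⟩
  | add s t hs ht =>
    obtain ⟨n, x1, x2, x3, rfl⟩ := hs
    obtain ⟨m, y1, y2, y3, rfl⟩ := ht
    exact ⟨n + m, Fin.append x1 y1, Fin.append x2 y2, Fin.append x3 y3,
      by simp [Fin.sum_univ_add]⟩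
  | tmul a s =>
    induction s with
    | zero => exact ⟨0, Fin.elim0, Fin.elim0, Fin.elim0, by simp⟩
    | add s t hs ht =>
      obtain ⟨n, x1, x2, x3, hs⟩ := hs
      obtain ⟨m, y1, y2, y3, ht⟩ := ht
      exact ⟨n + m, Fin.append x1 y1, Fin.append x2 y2, Fin.append x3 y3,
        by simp [Fin.sum_univ_add, TensorProduct.tmul_add, hs, ht]⟩
    | tmul b c => exact ⟨1, ![a], ![b], ![c], by simp⟩

lemma Rep2.convMul_apply [Bialgebra k X] {x : X} {n : ℕ} {x1 x2 : Fin n → X}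
    (h : Rep2 k x x1 x2) (f g : WithConv (X →ₐ[k] A)) :
    (f * g) x = ∑ i, f (x1 i) * g (x2 i) := by
  rw [Rep2] at h
  simp [AlgHom.convMul_apply, h]

lemma Rep3.convMul_apply [Bialgebra k X] {x : X} {n : ℕ} {x1 x2 x3 : Fin n → X}
    (h : Rep3 k x x1 x2 x3) (f g l : WithConv (X →ₐ[k] A)) :
    (f * (g * l)) x = ∑ i, f (x1 i) * (g (x2 i) * l (x3 i)) := by
  have key : ∀ t : X ⊗[k] X,
      Algebra.TensorProduct.lift f.ofConv (g * l).ofConv (fun _ _ ↦ .all ..) t =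
        LinearMap.mul' k A (TensorProduct.map f.ofConv.toLinearMap
          (LinearMap.mul' k A ∘ₗ TensorProduct.map g.ofConv.toLinearMap l.ofConv.toLinearMap)
          (LinearMap.lTensor X comul t)) := by
    intro t
    induction t with
    | zero => simp
    | add s t hs ht => simp only [map_add, hs, ht]
    | tmul a b => simp [AlgHom.convMul_def]; rfl
  rw [AlgHom.convMul_apply, key]
  change LinearMap.mul' k A (TensorProduct.map _ _ (delta3 k x)) = _
  rw [h]
  simp

lemma sum_counit_smul_right [Bialgebra k X] {ι : Type*} {x : X} (r : Coalgebra.Repr k x ι) :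
    ∑ i ∈ r.index, counit (R := k) (r.right i) • r.left i = x := by
  simpa only [map_sum, TensorProduct.rid_tmul, one_smul]
    using congrArg (TensorProduct.rid k X) (sum_tmul_counit_eq r)

/-- If `c` absorbs `g` through the counit, then convolving with `g` is invisible next to `c`. -/
lemma convMul_apply_mul_eq [Bialgebra k X] (f g : WithConv (X →ₐ[k] A)) {c : A}
    (h : ∀ x, g x * c = counit (R := k) x • c) (x : X) : (f * g) x * c = f x * c := by
  have hx : (f * g) x = ∑ i ∈ (ℛ k x).index, f ((ℛ k x).left i) * g ((ℛ k x).right i) := by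
    rw [AlgHom.convMul_apply, ← (ℛ k x).eq]
    simp
  have hf := congrArg (fun t ↦ f t * c) (sum_counit_smul_right (ℛ k x))
  simp only [map_sum, map_smul, Finset.sum_mul] at hf
  rw [hx, Finset.sum_mul, ← hf]
  refine Finset.sum_congr rfl fun i _ ↦ ?_
  rw [mul_assoc, h, mul_smul_comm, smul_mul_assoc]

/-- The convolution inverse of an algebra homomorphism out of a commutative Hopf algebra. -/
noncomputable def compAntipode [HopfAlgebra k X] (f : WithConv (X →ₐ[k] A)) :
    WithConv (X →ₐ[k] A) :=
  toConv (f.ofConv.comp (HopfAlgebra.antipodeAlgHom k X))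

lemma compAntipode_apply [HopfAlgebra k X] (f : WithConv (X →ₐ[k] A)) (x : X) :
    compAntipode f x = f (HopfAlgebra.antipode k x) := rfl

lemma compAntipode_mul_self [HopfAlgebra k X] (f : WithConv (X →ₐ[k] A)) :
    compAntipode f * f = 1 := by
  have h := AlgHom.comp_convMul_distrib f.ofConv
    (toConv (HopfAlgebra.antipodeAlgHom k X)) (toConv (AlgHom.id k X))
  rw [AlgHom.antipode_id_cancel] at h
  refine (WithConv.ext h).symm.trans ?_
  ext x
  simp [AlgHom.convOne_def]

lemma compAntipode_mul [HopfAlgebra k X] [IsCocomm k X] (f g : WithConv (X →ₐ[k] A)) :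
    compAntipode (f * g) = compAntipode f * compAntipode g := by
  refine left_inv_eq_right_inv (compAntipode_mul_self (f * g)) ?_
  rw [mul_comm, mul_mul_mul_comm, compAntipode_mul_self, compAntipode_mul_self, one_mul]

lemma mul_compAntipode_mul_mul_cancel [HopfAlgebra k X] [IsCocomm k X]
    (f g h : WithConv (X →ₐ[k] A)) : f * compAntipode h * (g * h) = f * g := by
  rw [mul_mul_mul_comm, compAntipode_mul_self, mul_one]

end Convolution

/-- the cap `∩(1) = Δ(γ)` commutes with the braiding:
`β(γ⁽¹⁾ ⊗ γ⁽²⁾ ⊗ x ⊗ y) = x ⊗ y ⊗ γ⁽¹⁾ ⊗ γ⁽²⁾` and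
`β(x ⊗ y ⊗ γ⁽¹⁾ ⊗ γ⁽²⁾) = γ⁽¹⁾ ⊗ γ⁽²⁾ ⊗ x ⊗ y`. -/
theorem cap_commutes_with_braiding (k X : Type*) [CommRing k] [CommRing X] [HopfAlgebra k X]
    (S : X →ₗ[k] X) (hS : S = HopfAlgebra.antipode (R := k))
    (hinv : ∀ a : X, S (S a) = a)
    (hcc : ∀ a : X, TensorProduct.comm k X X (Coalgebra.comul a) = Coalgebra.comul a)
    (γ : X) (hγ : IsCointegral k γ)
    (β : (X ⊗[k] X) ⊗[k] (X ⊗[k] X) →ₗ[k] (X ⊗[k] X) ⊗[k] (X ⊗[k] X))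
    (hβ : ∀ (x y z w : X) {n m : ℕ} (z1 z2 z3 : Fin n → X) (w1 w2 w3 : Fin m → X),
      Rep3 k z z1 z2 z3 → Rep3 k w w1 w2 w3 →
      β ((x ⊗ₜ[k] y) ⊗ₜ[k] (z ⊗ₜ[k] w)) =
        ∑ i, ∑ j, (z1 i ⊗ₜ[k] w1 j) ⊗ₜ[k]
          ((x * S (z2 i) * w2 j) ⊗ₜ[k] (y * S (z3 i) * w3 j)))
    (x y : X) {n : ℕ} (γ1 γ2 : Fin n → X) (hrep : Rep2 k γ γ1 γ2) :
    (∑ i, β ((γ1 i ⊗ₜ[k] γ2 i) ⊗ₜ[k] (x ⊗ₜ[k] y)) =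
      ∑ i, (x ⊗ₜ[k] y) ⊗ₜ[k] (γ1 i ⊗ₜ[k] γ2 i)) ∧
    (∑ i, β ((x ⊗ₜ[k] y) ⊗ₜ[k] (γ1 i ⊗ₜ[k] γ2 i)) =
      ∑ i, (γ1 i ⊗ₜ[k] γ2 i) ⊗ₜ[k] (x ⊗ₜ[k] y)) := by
  have : IsCocomm k X := ⟨LinearMap.ext hcc⟩
  let L : X ⊗[k] X →ₐ[k] (X ⊗[k] X) ⊗[k] (X ⊗[k] X) := Algebra.TensorProduct.includeLeft
  let R : X ⊗[k] X →ₐ[k] (X ⊗[k] X) ⊗[k] (X ⊗[k] X) := Algebra.TensorProduct.includeRight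
  let l : X →ₐ[k] X ⊗[k] X := Algebra.TensorProduct.includeLeft
  let r : X →ₐ[k] X ⊗[k] X := Algebra.TensorProduct.includeRight
  let j₁ : WithConv (X →ₐ[k] (X ⊗[k] X) ⊗[k] (X ⊗[k] X)) := toConv (L.comp l)
  let j₂ : WithConv (X →ₐ[k] (X ⊗[k] X) ⊗[k] (X ⊗[k] X)) := toConv (L.comp r)
  let j₃ : WithConv (X →ₐ[k] (X ⊗[k] X) ⊗[k] (X ⊗[k] X)) := toConv (R.comp l)
  let j₄ : WithConv (X →ₐ[k] (X ⊗[k] X) ⊗[k] (X ⊗[k] X)) := toConv (R.comp r)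
  have hβ' (p : X ⊗[k] X) (z w : X) :
      β (p ⊗ₜ (z ⊗ₜ w)) =
        R p * ((j₁ * (compAntipode j₃ * compAntipode j₄)) z * (j₂ * (j₃ * j₄)) w) := by
    induction p with
    | zero => simp
    | add p q hp hq => simp only [TensorProduct.add_tmul, map_add, hp, hq, add_mul]
    | tmul a b =>
      obtain ⟨n, z1, z2, z3, hz⟩ := exists_rep3_s9 (k := k) z
      obtain ⟨m, w1, w2, w3, hw⟩ := exists_rep3_s9 (k := k) w
      rw [hβ a b z w z1 z2 z3 w1 w2 w3 hz hw, hz.convMul_apply, hw.convMul_apply,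
        Finset.sum_mul_sum, Finset.mul_sum]
      refine Finset.sum_congr rfl fun i _ ↦ ?_
      rw [Finset.mul_sum]
      refine Finset.sum_congr rfl fun j _ ↦ ?_
      simp [compAntipode_apply, hS, j₁, j₂, j₃, j₄, L, R, l, r, mul_assoc]
  have hd (c : X) : (j₃ * j₄) c = R (comul c) := by
    rw [AlgHom.convMul_apply, ← (ℛ k c).eq]
    simp [j₃, j₄, l, r, ← map_mul]
  have habs (c : X) :
      (j₃ * j₄) c * R (comul γ) = counit (R := k) c • R (comul γ) := by
    rw [hd, ← map_mul, ← Bialgebra.comul_mul, (hγ c).1, map_smul, map_smul]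
  have habs_inv (c : X) :
      (compAntipode j₃ * compAntipode j₄) c * R (comul γ) = counit (R := k) c • R (comul γ) := by
    rw [← compAntipode_mul]
    exact (habs (HopfAlgebra.antipode k c)).trans (by rw [HopfAlgebra.counit_antipode])
  have hrep' : comul (R := k) γ = ∑ i, γ1 i ⊗ₜ[k] γ2 i := hrep
  constructor
  · rw [← map_sum, ← TensorProduct.sum_tmul, ← TensorProduct.tmul_sum, ← hrep', hβ']
    calc
      _ = (j₁ * (compAntipode j₃ * compAntipode j₄)) x * ((j₂ * (j₃ * j₄)) y * R (comul γ)) := by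
        ring
      _ = j₂ y * ((j₁ * (compAntipode j₃ * compAntipode j₄)) x * R (comul γ)) := by
        rw [convMul_apply_mul_eq j₂ _ habs]; ring
      _ = _ := by
        rw [convMul_apply_mul_eq j₁ _ habs_inv]
        simp [j₁, j₂, L, R, l, r]
  · simp only [hβ']
    rw [← Finset.mul_sum, ← Rep2.convMul_apply hrep, ← compAntipode_mul,
      mul_compAntipode_mul_mul_cancel, Rep2.convMul_apply hrep,
      Finset.mul_sum]
    simp [j₁, j₂, L, R, l, r]
end

section
/- Let X be a commutative and cocommutative Hopf algebra over a commutative ring k with S ∘ S = id, and let λ : X → k be a two-sided integral functional. Set V = X⊗X, define ∪ : X⊗X → k by ∪(a⊗b) = λ(a·S(b)), μ₂ = id_X ⊗ ∪ ⊗ id_X : V⊗V → V, and let β : V⊗V → V⊗V be the braiding β(x⊗y⊗z⊗w) = z⁽¹⁾ ⊗ w⁽¹⁾ ⊗ x·S(z⁽²⁾)·w⁽²⁾ ⊗ y·S(z⁽³⁾)·w⁽³⁾. Then the multiplication commutes with the braiding: β ∘ (μ₂ ⊗ id_V) = (id_V ⊗ μ₂) ∘ (β ⊗ id_V) ∘ (id_V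 ⊗ β) and β ∘ (id_V ⊗ μ₂) = (μ₂ ⊗ id_V) ∘ (id_V ⊗ β) ∘ (β ⊗ id_V), as k-linear maps V^{⊗3} → V^{⊗2}. -/
open TensorProduct

namespace HopfAlgebra

open Coalgebra Bialgebra WithConv

variable {k X : Type*} [CommRing k] [CommRing X] [HopfAlgebra k X]

section Convolution

variable {C : Type*} [CommRing C] [Algebra k C]

lemma comp_antipode_convMul (f : X →ₐ[k] C) :
    toConv (f.comp (antipodeAlgHom k X)) * toConv f = 1 := by
  have h := AlgHom.comp_convMul_distrib f (toConv (antipodeAlgHom k X)) (toConv (AlgHom.id k X))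
  rw [AlgHom.antipode_id_cancel] at h
  apply WithConv.ofConv_injective
  refine Eq.trans h.symm ?_
  ext a
  simp [AlgHom.convOne_def]

lemma convMul_comp_antipode (f : X →ₐ[k] C) :
    toConv f * toConv (f.comp (antipodeAlgHom k X)) = 1 := by
  have h := AlgHom.comp_convMul_distrib f (toConv (AlgHom.id k X)) (toConv (antipodeAlgHom k X))
  have h' : toConv (AlgHom.id k X) * toConv (antipodeAlgHom k X) = 1 := by
    apply WithConv.ofConv_injective
    apply AlgHom.toLinearMap_injective
    apply WithConv.toConv_injective
    rw [AlgHom.toLinearMap_convMul, AlgHom.toLinearMap_convOne]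
    simp [LinearMap.id_mul_antipode]
  rw [h'] at h
  apply WithConv.ofConv_injective
  refine Eq.trans h.symm ?_
  ext a
  simp [AlgHom.convOne_def]

lemma convMul_mul_comp_antipode_mul (f g h : X →ₐ[k] C) :
    (toConv f * toConv g) * (toConv (g.comp (antipodeAlgHom k X)) * toConv h) =
      toConv f * toConv h := by
  rw [mul_assoc, ← mul_assoc (toConv g), convMul_comp_antipode, one_mul]

end Convolution

/-- In a commutative and cocommutative Hopf algebra the antipode preserves `Δ`. -/
lemma map_antipode_comul [IsCocomm k X] (a : X) :
    TensorProduct.map (antipode k) (antipode k) (comul (R := k) a) =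
      comul (R := k) (antipode k a) := by
  let i₁ : X →ₐ[k] X ⊗[k] X := Algebra.TensorProduct.includeLeft
  let i₂ : X →ₐ[k] X ⊗[k] X := Algebra.TensorProduct.includeRight
  have hΔ : toConv (comulAlgHom k X) = toConv i₁ * toConv i₂ := by
    apply WithConv.ofConv_injective
    ext a
    rw [AlgHom.convMul_apply]
    change comul (R := k) a = _
    induction comul (R := k) a with
    | zero => simp
    | tmul x y => simp [i₁, i₂]
    | add x y hx hy => simp only [map_add, ← hx, ← hy]
  have h : toConv (i₁.comp (antipodeAlgHom k X)) * toConv (i₂.comp (antipodeAlgHom k X)) =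
      toConv ((comulAlgHom k X).comp (antipodeAlgHom k X)) := by
    refine left_inv_eq_right_inv ?_ (convMul_comp_antipode (comulAlgHom k X))
    rw [hΔ, mul_mul_mul_comm, comp_antipode_convMul, comp_antipode_convMul, one_mul]
  have ha := congrArg (fun f ↦ f.ofConv a) h
  refine Eq.trans ?_ ha
  rw [AlgHom.convMul_apply]
  induction comul (R := k) a with
  | zero => simp
  | tmul x y => simp [i₁, i₂]
  | add x y hx hy => simp only [map_add, ← hx, ← hy]

/-- The antipode of a commutative and cocommutative Hopf algebra as a bialgebra map. -/
noncomputable def antipodeBialgHom [IsCocomm k X] : X →ₐc[k] X :=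
  .ofAlgHom (antipodeAlgHom k X) (AlgHom.counitAlgHom_comp_antipodeAlgHom)
    (AlgHom.ext map_antipode_comul)

/-- The bialgebra map `z ⊗ w ↦ S(z) w`. -/
noncomputable def leftQuotient [IsCocomm k X] : X ⊗[k] X →ₐc[k] X :=
  (mulBialgHom k X).comp (Bialgebra.TensorProduct.map antipodeBialgHom (.id k X))

@[simp]
lemma leftQuotient_tmul [IsCocomm k X] (z w : X) :
    leftQuotient (k := k) (z ⊗ₜ[k] w) = antipode k z * w := rfl

/-- The algebra map `z ⊗ w ↦ Δ(S(z) w)`. -/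
noncomputable def comulLeftQuotient [IsCocomm k X] : X ⊗[k] X →ₐ[k] X ⊗[k] X :=
  (comulAlgHom k X).comp (leftQuotient : X ⊗[k] X →ₐc[k] X)

@[simp]
lemma comulLeftQuotient_apply [IsCocomm k X] (q : X ⊗[k] X) :
    comulLeftQuotient (k := k) q = comul (R := k) (leftQuotient q) := rfl

lemma map_comulLeftQuotient_comul [IsCocomm k X] (r : X ⊗[k] X) :
    TensorProduct.map comulLeftQuotient.toLinearMap comulLeftQuotient.toLinearMap
        (comul (R := k) r) =
      TensorProduct.map comul comul (comul (R := k) (leftQuotient (k := k) r)) := by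
  rw [← CoalgHomClass.map_comp_comul_apply, TensorProduct.map_map]
  rfl

/-- `(a ⊗ b) ⊗ (c ⊗ d) ↦ a ⊗ (b S(c) ⊗ d)`. -/
noncomputable def middleQuotient :
    (X ⊗[k] X) ⊗[k] (X ⊗[k] X) →ₐ[k] X ⊗[k] (X ⊗[k] X) :=
  Algebra.TensorProduct.lift
    (Algebra.TensorProduct.lift Algebra.TensorProduct.includeLeft
      (Algebra.TensorProduct.includeRight.comp Algebra.TensorProduct.includeLeft)
      (fun _ _ ↦ Commute.all _ _))
    (Algebra.TensorProduct.lift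
      ((Algebra.TensorProduct.includeRight.comp Algebra.TensorProduct.includeLeft).comp
        (antipodeAlgHom k X))
      (Algebra.TensorProduct.includeRight.comp Algebra.TensorProduct.includeRight)
      (fun _ _ ↦ Commute.all _ _))
    (fun _ _ ↦ Commute.all _ _)

@[simp]
lemma middleQuotient_tmul (a b c d : X) :
    middleQuotient (k := k) ((a ⊗ₜ[k] b) ⊗ₜ[k] (c ⊗ₜ[k] d)) =
      a ⊗ₜ[k] ((b * antipode k c) ⊗ₜ[k] d) := by
  simp [middleQuotient]

/-- `a⁽¹⁾ ⊗ a⁽²⁾ S(a⁽³⁾) ⊗ a⁽⁴⁾ = a⁽¹⁾ ⊗ 1 ⊗ a⁽²⁾`. -/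
lemma middleQuotient_comul (a : X) :
    middleQuotient (k := k) (TensorProduct.map comul comul (comul (R := k) a)) =
      LinearMap.lTensor X (TensorProduct.mk k X X 1) (comul (R := k) a) := by
  let j₁ : X →ₐ[k] X ⊗[k] (X ⊗[k] X) := Algebra.TensorProduct.includeLeft
  let j₂ : X →ₐ[k] X ⊗[k] (X ⊗[k] X) :=
    Algebra.TensorProduct.includeRight.comp Algebra.TensorProduct.includeLeft
  let j₃ : X →ₐ[k] X ⊗[k] (X ⊗[k] X) :=
    Algebra.TensorProduct.includeRight.comp Algebra.TensorProduct.includeRight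
  have ha := congrArg (fun f ↦ f.ofConv a) (convMul_mul_comp_antipode_mul j₁ j₂ j₃)
  beta_reduce at ha
  refine Eq.trans ?_ (ha.trans ?_)
  · rw [AlgHom.convMul_apply]
    induction comul (R := k) a with
    | zero => simp
    | tmul x y =>
      rw [TensorProduct.map_tmul, Algebra.TensorProduct.lift_tmul, AlgHom.convMul_apply,
        AlgHom.convMul_apply, middleQuotient, Algebra.TensorProduct.lift_tmul]
    | add x y hx hy => simp only [map_add, hx, hy]
  · rw [AlgHom.convMul_apply]
    induction comul (R := k) a with
    | zero => simp
    | tmul x y => simp [j₁, j₃]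
    | add x y hx hy => simp only [map_add, hx, hy]

/-- A two-sided integral functional satisfies `λ(a⁽¹⁾) a⁽²⁾ = λ(a) 1`. -/
lemma _root_.IsIntegralFunctional.lift_comul {lam : X →ₗ[k] k}
    (hlam : IsIntegralFunctional k lam) (a : X) :
    TensorProduct.lift (LinearMap.lsmul k X ∘ₗ lam) (comul (R := k) a) = lam a • (1 : X) := by
  obtain ⟨n, x₁, x₂, h⟩ := TensorProduct.exists_sum_tmul_eq (comul (R := k) a)
  rw [← (hlam a x₁ x₂ h).2, h]
  simp

section Pairing

variable {lam : X →ₗ[k] k} {μ : (X ⊗[k] X) ⊗[k] (X ⊗[k] X) →ₗ[k] X ⊗[k] X}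

/-- `μ₂` is linear over the diagonal action of `X` through the iterated comultiplication. -/
lemma pairing_mul_comul
    (hμ : ∀ x y z w : X,
      μ ((x ⊗ₜ[k] y) ⊗ₜ[k] (z ⊗ₜ[k] w)) = lam (y * antipode k z) • (x ⊗ₜ[k] w))
    (p q : X ⊗[k] X) (a : X) :
    μ ((p ⊗ₜ[k] q) * TensorProduct.map comul comul (comul (R := k) a)) =
      μ (p ⊗ₜ[k] q) * comul (R := k) a := by
  induction p with
  | zero => simp
  | add p₁ p₂ h₁ h₂ => simp only [TensorProduct.add_tmul, add_mul, map_add, h₁, h₂]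
  | tmul x y =>
  induction q with
  | zero => simp
  | add q₁ q₂ h₁ h₂ => simp only [TensorProduct.tmul_add, add_mul, map_add, h₁, h₂]
  | tmul z w =>
  let L : X ⊗[k] (X ⊗[k] X) →ₗ[k] X ⊗[k] X :=
    TensorProduct.map (LinearMap.mulLeft k x)
      (TensorProduct.lift (LinearMap.lsmul k X ∘ₗ lam) ∘ₗ
        TensorProduct.map (LinearMap.mulLeft k (y * antipode k z)) (LinearMap.mulLeft k w))
  have hL (t : (X ⊗[k] X) ⊗[k] (X ⊗[k] X)) :
      μ (((x ⊗ₜ[k] y) ⊗ₜ[k] (z ⊗ₜ[k] w)) * t) = L (middleQuotient t) := by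
    have : μ ∘ₗ LinearMap.mulLeft k ((x ⊗ₜ[k] y) ⊗ₜ[k] (z ⊗ₜ[k] w)) =
        L ∘ₗ (middleQuotient (k := k) (X := X)).toLinearMap := by
      ext a b c d
      have : y * b * (antipode k z * antipode k c) = y * (antipode k z * (b * antipode k c)) := by
        ring
      simp [L, hμ, antipode_mul_distrib, this]
    exact LinearMap.congr_fun this t
  rw [hL, middleQuotient_comul, hμ]
  induction comul (R := k) a with
  | zero => simp
  | add s t hs ht => simp only [map_add, mul_add, hs, ht]
  | tmul b c => simp [L]

/-- `λ` is applied to one leg of the product of `s` and `(S ⊗ S)(t)`. -/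
lemma map_pairing_tensorTensorTensorComm [IsCocomm k X]
    (hμ : ∀ x y z w : X,
      μ ((x ⊗ₜ[k] y) ⊗ₜ[k] (z ⊗ₜ[k] w)) = lam (y * antipode k z) • (x ⊗ₜ[k] w))
    (z₁ z₂ v₁ v₂ : X) (s t : X ⊗[k] X) :
    TensorProduct.map μ
        (LinearMap.mul' k (X ⊗[k] X) ∘ₗ TensorProduct.map
          comulLeftQuotient.toLinearMap comulLeftQuotient.toLinearMap)
        (TensorProduct.tensorTensorTensorComm k _ _ _ _
          (TensorProduct.tensorTensorTensorComm k _ _ _ _ ((z₁ ⊗ₜ[k] z₂) ⊗ₜ[k] s) ⊗ₜ[k]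
            TensorProduct.tensorTensorTensorComm k _ _ _ _ (t ⊗ₜ[k] (v₁ ⊗ₜ[k] v₂)))) =
      (z₁ ⊗ₜ[k] v₁) ⊗ₜ[k] comul (R := k) (antipode k z₂ * v₂ *
        TensorProduct.lift (LinearMap.lsmul k X ∘ₗ lam)
          (s * TensorProduct.map (antipode k) (antipode k) t)) := by
  induction s with
  | zero => simp only [TensorProduct.tmul_zero, TensorProduct.zero_tmul, map_zero, zero_mul,
      mul_zero]
  | add s₁ s₂ h₁ h₂ =>
    simp only [TensorProduct.tmul_add, TensorProduct.add_tmul, add_mul, mul_add, map_add, h₁, h₂]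
  | tmul w₁ w₂ =>
  induction t with
  | zero => simp only [TensorProduct.tmul_zero, TensorProduct.zero_tmul, map_zero, mul_zero]
  | add t₁ t₂ h₁ h₂ =>
    simp only [TensorProduct.tmul_add, TensorProduct.add_tmul, mul_add, map_add, h₁, h₂]
  | tmul u₁ u₂ =>
  have : antipode k z₂ * w₂ * (antipode k u₂ * v₂) =
      antipode k z₂ * v₂ * (w₂ * antipode k u₂) := by
    ring
  simp only [TensorProduct.tensorTensorTensorComm_tmul, TensorProduct.map_tmul, hμ,
    LinearMap.comp_apply, AlgHom.toLinearMap_apply, comulLeftQuotient_apply,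
    leftQuotient_tmul, LinearMap.mul'_apply, ← comul_mul, this,
    Algebra.TensorProduct.tmul_mul_tmul, TensorProduct.lift.tmul, LinearMap.lsmul_apply,
    map_smul, mul_smul_comm, TensorProduct.tmul_smul, TensorProduct.smul_tmul']

/-- The integral property turns the comultiplication of `V ⊗ V` into that of `V` under `μ₂`. -/
lemma map_pairing_comul [IsCocomm k X] (hlam : IsIntegralFunctional k lam)
    (hμ : ∀ x y z w : X,
      μ ((x ⊗ₜ[k] y) ⊗ₜ[k] (z ⊗ₜ[k] w)) = lam (y * antipode k z) • (x ⊗ₜ[k] w))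
    (q r : X ⊗[k] X) :
    TensorProduct.map μ
        (LinearMap.mul' k (X ⊗[k] X) ∘ₗ TensorProduct.map
          comulLeftQuotient.toLinearMap comulLeftQuotient.toLinearMap)
        (TensorProduct.tensorTensorTensorComm k _ _ _ _
          (comul (R := k) q ⊗ₜ[k] comul (R := k) r)) =
      LinearMap.lTensor (X ⊗[k] X) comulLeftQuotient.toLinearMap
        (comul (R := k) (μ (q ⊗ₜ[k] r))) := by
  induction q with
  | zero => simp
  | add q₁ q₂ h₁ h₂ => simp only [TensorProduct.add_tmul, map_add, h₁, h₂]
  | tmul z w =>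
  induction r with
  | zero => simp
  | add r₁ r₂ h₁ h₂ => simp only [TensorProduct.tmul_add, map_add, h₁, h₂]
  | tmul u v =>
  rw [hμ, map_smul, map_smul]
  simp only [TensorProduct.comul_tmul]
  induction comul (R := k) z with
  | zero => simp
  | add s₁ s₂ h₁ h₂ => simp only [TensorProduct.add_tmul, map_add, smul_add, h₁, h₂]
  | tmul z₁ z₂ =>
  induction comul (R := k) v with
  | zero => simp
  | add t₁ t₂ h₁ h₂ => simp only [TensorProduct.tmul_add, map_add, smul_add, h₁, h₂]
  | tmul v₁ v₂ =>
  simp only [AlgebraTensorModule.tensorTensorTensorComm_eq]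
  rw [map_pairing_tensorTensorTensorComm hμ,
    map_antipode_comul, ← comul_mul, hlam.lift_comul]
  simp

end Pairing

/-- Every element has a finite family representing its iterated comultiplication. -/
lemma exists_rep3 (x : X) :
    ∃ (n : ℕ) (x₁ x₂ x₃ : Fin n → X), Rep3 k x x₁ x₂ x₃ := by
  unfold Rep3
  induction delta3 k x with
  | zero => exact ⟨0, IsEmpty.elim inferInstance, IsEmpty.elim inferInstance,
      IsEmpty.elim inferInstance, by simp⟩
  | tmul a t =>
    obtain ⟨n, b, c, rfl⟩ := TensorProduct.exists_sum_tmul_eq t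
    exact ⟨n, fun _ ↦ a, b, c, by rw [TensorProduct.tmul_sum]⟩
  | add s t hs ht =>
    obtain ⟨n, a, b, c, rfl⟩ := hs
    obtain ⟨m, a', b', c', rfl⟩ := ht
    exact ⟨n + m, Fin.addCases a a', Fin.addCases b b', Fin.addCases c c', by
      simp [Fin.sum_univ_add]⟩

section Braiding

variable [IsCocomm k X]

/-- The braiding `p ⊗ q ↦ q⁽¹⁾ ⊗ p Δ(S(z) w)` where `q⁽²⁾ = z ⊗ w`. -/
lemma braiding_tmul
    {β : (X ⊗[k] X) ⊗[k] (X ⊗[k] X) →ₗ[k] (X ⊗[k] X) ⊗[k] (X ⊗[k] X)}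
    (hβ : ∀ (x y z w : X) {n m : ℕ} (z1 z2 z3 : Fin n → X) (w1 w2 w3 : Fin m → X),
      Rep3 k z z1 z2 z3 → Rep3 k w w1 w2 w3 →
      β ((x ⊗ₜ[k] y) ⊗ₜ[k] (z ⊗ₜ[k] w)) =
        ∑ i, ∑ j, (z1 i ⊗ₜ[k] w1 j) ⊗ₜ[k]
          ((x * antipode k (z2 i) * w2 j) ⊗ₜ[k] (y * antipode k (z3 i) * w3 j)))
    (p q : X ⊗[k] X) :
    β (p ⊗ₜ[k] q) =
      LinearMap.lTensor (X ⊗[k] X)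
        (LinearMap.mulLeft k p ∘ₗ comulLeftQuotient.toLinearMap) (comul (R := k) q) := by
  induction p with
  | zero => simp
  | add p₁ p₂ h₁ h₂ =>
    rw [TensorProduct.add_tmul, map_add, h₁, h₂, ← LinearMap.add_apply, ← LinearMap.lTensor_add,
      ← LinearMap.add_comp]
    congr
    ext
    simp [add_mul]
  | tmul x y =>
  induction q with
  | zero => simp
  | add q₁ q₂ h₁ h₂ => simp only [TensorProduct.tmul_add, map_add, h₁, h₂]
  | tmul z w =>
  obtain ⟨n, z₁, z₂, z₃, hz⟩ := exists_rep3 (k := k) z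
  obtain ⟨m, w₁, w₂, w₃, hw⟩ := exists_rep3 (k := k) w
  let G : (X ⊗[k] (X ⊗[k] X)) ⊗[k] (X ⊗[k] (X ⊗[k] X)) →ₗ[k] (X ⊗[k] X) ⊗[k] (X ⊗[k] X) :=
    LinearMap.lTensor (X ⊗[k] X) (LinearMap.mulLeft k (x ⊗ₜ[k] y) ∘ₗ LinearMap.mul' k (X ⊗[k] X) ∘ₗ
      LinearMap.rTensor (X ⊗[k] X) (TensorProduct.map (antipode k) (antipode k))) ∘ₗ
      (TensorProduct.tensorTensorTensorComm k X (X ⊗[k] X) X (X ⊗[k] X)).toLinearMap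
  trans G (delta3 k z ⊗ₜ[k] delta3 k w)
  · rw [hβ x y z w z₁ z₂ z₃ w₁ w₂ w₃ hz hw, hz, hw]
    simp [G, TensorProduct.sum_tmul, TensorProduct.tmul_sum, mul_assoc]
    exact Finset.sum_comm
  · simp only [delta3, TensorProduct.comul_tmul, LinearMap.comp_apply]
    induction comul (R := k) z with
    | zero => simp
    | add s₁ s₂ h₁ h₂ => simp only [TensorProduct.add_tmul, map_add, h₁, h₂]
    | tmul a b =>
    induction comul (R := k) w with
    | zero => simp
    | add t₁ t₂ h₁ h₂ => simp only [TensorProduct.tmul_add, map_add, h₁, h₂]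
    | tmul c d => simp [G, map_antipode_comul]

/-- `(id ⊗ μ) ∘ (β ⊗ id) ∘ (id ⊗ β)` on `p ⊗ q ⊗ r`, in terms of `Δ(r)`. -/
lemma lTensor_beta12_beta23 (β : (X ⊗[k] X) ⊗[k] (X ⊗[k] X) →ₗ[k] (X ⊗[k] X) ⊗[k] (X ⊗[k] X))
    (μ : (X ⊗[k] X) ⊗[k] (X ⊗[k] X) →ₗ[k] X ⊗[k] X)
    (hβ : ∀ p q : X ⊗[k] X, β (p ⊗ₜ[k] q) = LinearMap.lTensor (X ⊗[k] X)
      (LinearMap.mulLeft k p ∘ₗ comulLeftQuotient.toLinearMap) (comul (R := k) q))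
    (p q r : X ⊗[k] X) :
    LinearMap.lTensor (X ⊗[k] X) μ (beta12 β (beta23 β (p ⊗ₜ[k] (q ⊗ₜ[k] r)))) =
      LinearMap.lTensor (X ⊗[k] X) (μ ∘ₗ LinearMap.mulLeft k (p ⊗ₜ[k] q) ∘ₗ
        TensorProduct.map comulLeftQuotient.toLinearMap comulLeftQuotient.toLinearMap ∘ₗ
          comul) (comul (R := k) r) := by
  rw [← LinearMap.comp_assoc comul, ← LinearMap.comp_assoc comul, LinearMap.lTensor_comp,
    LinearMap.comp_apply, ← coassoc_apply, beta23, LinearMap.lTensor_tmul, hβ]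
  induction comul (R := k) r with
  | zero => simp
  | add s t hs ht => simp only [TensorProduct.tmul_add, map_add, hs, ht]
  | tmul r₁ r₂ =>
  simp only [beta12, LinearMap.comp_apply, LinearMap.lTensor_tmul, LinearMap.rTensor_tmul,
    LinearEquiv.coe_coe, TensorProduct.assoc_symm_tmul, TensorProduct.map_tmul, hβ]
  induction comul (R := k) r₁ with
  | zero => simp
  | add s t hs ht => simp only [TensorProduct.add_tmul, map_add, hs, ht]
  | tmul s t => simp

/-- `(μ ⊗ id) ∘ (id ⊗ β) ∘ (β ⊗ id)` on `p ⊗ q ⊗ r`, in terms of `Δ(q)` and `Δ(r)`. -/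
lemma map_beta23_beta12 (β : (X ⊗[k] X) ⊗[k] (X ⊗[k] X) →ₗ[k] (X ⊗[k] X) ⊗[k] (X ⊗[k] X))
    (μ : (X ⊗[k] X) ⊗[k] (X ⊗[k] X) →ₗ[k] X ⊗[k] X)
    (hβ : ∀ p q : X ⊗[k] X, β (p ⊗ₜ[k] q) = LinearMap.lTensor (X ⊗[k] X)
      (LinearMap.mulLeft k p ∘ₗ comulLeftQuotient.toLinearMap) (comul (R := k) q))
    (p q r : X ⊗[k] X) :
    TensorProduct.map μ LinearMap.id ((TensorProduct.assoc k (X ⊗[k] X) (X ⊗[k] X) (X ⊗[k] X)).symm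
        (beta23 β (beta12 β (p ⊗ₜ[k] (q ⊗ₜ[k] r))))) =
      LinearMap.lTensor (X ⊗[k] X) (LinearMap.mulLeft k p) (TensorProduct.map μ
        (LinearMap.mul' k (X ⊗[k] X) ∘ₗ TensorProduct.map
          comulLeftQuotient.toLinearMap comulLeftQuotient.toLinearMap)
        (TensorProduct.tensorTensorTensorComm k _ _ _ _
          (comul (R := k) q ⊗ₜ[k] comul (R := k) r))) := by
  simp only [beta12, beta23, LinearMap.comp_apply, LinearEquiv.coe_coe,
    TensorProduct.assoc_symm_tmul, TensorProduct.map_tmul, hβ]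
  induction comul (R := k) q with
  | zero => simp
  | add s t hs ht => simp only [TensorProduct.add_tmul, map_add, hs, ht]
  | tmul q₁ q₂ =>
  simp only [LinearMap.lTensor_tmul, LinearMap.id_apply, TensorProduct.assoc_tmul, hβ]
  induction comul (R := k) r with
  | zero => simp
  | add s t hs ht => simp only [TensorProduct.tmul_add, map_add, hs, ht]
  | tmul r₁ r₂ => simp

end Braiding

end HopfAlgebra

/-- the multiplication `μ₂ = id ⊗ ∪ ⊗ id` on `V = X ⊗ X` commutes with the
braiding `β`: `β ∘ (μ₂ ⊗ id) = (id ⊗ μ₂) ∘ (β ⊗ id) ∘ (id ⊗ β)` and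
`β ∘ (id ⊗ μ₂) = (μ₂ ⊗ id) ∘ (id ⊗ β) ∘ (β ⊗ id)`. -/
theorem multiplication_commutes_with_braiding (k X : Type*) [CommRing k] [CommRing X]
    [HopfAlgebra k X]
    (S : X →ₗ[k] X) (hS : S = HopfAlgebra.antipode (R := k))
    (hinv : ∀ a : X, S (S a) = a)
    (hcc : ∀ a : X, TensorProduct.comm k X X (Coalgebra.comul a) = Coalgebra.comul a)
    (lam : X →ₗ[k] k) (hlam : IsIntegralFunctional k lam)
    (μ₂ : (X ⊗[k] X) ⊗[k] (X ⊗[k] X) →ₗ[k] X ⊗[k] X)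
    (hμ : ∀ x y z w : X,
      μ₂ ((x ⊗ₜ[k] y) ⊗ₜ[k] (z ⊗ₜ[k] w)) = lam (y * S z) • (x ⊗ₜ[k] w))
    (β : (X ⊗[k] X) ⊗[k] (X ⊗[k] X) →ₗ[k] (X ⊗[k] X) ⊗[k] (X ⊗[k] X))
    (hβ : ∀ (x y z w : X) {n m : ℕ} (z1 z2 z3 : Fin n → X) (w1 w2 w3 : Fin m → X),
      Rep3 k z z1 z2 z3 → Rep3 k w w1 w2 w3 →
      β ((x ⊗ₜ[k] y) ⊗ₜ[k] (z ⊗ₜ[k] w)) =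
        ∑ i, ∑ j, (z1 i ⊗ₜ[k] w1 j) ⊗ₜ[k]
          ((x * S (z2 i) * w2 j) ⊗ₜ[k] (y * S (z3 i) * w3 j))) :
    (β ∘ₗ TensorProduct.map μ₂ LinearMap.id ∘ₗ
        (TensorProduct.assoc k (X ⊗[k] X) (X ⊗[k] X) (X ⊗[k] X)).symm.toLinearMap =
      LinearMap.lTensor (X ⊗[k] X) μ₂ ∘ₗ beta12 β ∘ₗ beta23 β) ∧
    (β ∘ₗ LinearMap.lTensor (X ⊗[k] X) μ₂ =
      TensorProduct.map μ₂ LinearMap.id ∘ₗ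
        (TensorProduct.assoc k (X ⊗[k] X) (X ⊗[k] X) (X ⊗[k] X)).symm.toLinearMap ∘ₗ
          beta23 β ∘ₗ beta12 β) := by
  subst hS
  have : Coalgebra.IsCocomm k X := ⟨LinearMap.ext hcc⟩
  have hβ' := HopfAlgebra.braiding_tmul hβ
  constructor
  · refine TensorProduct.ext_threefold' fun p q r ↦ ?_
    simp only [LinearMap.comp_apply, LinearEquiv.coe_coe, TensorProduct.assoc_symm_tmul,
      TensorProduct.map_tmul, LinearMap.id_apply]
    rw [HopfAlgebra.lTensor_beta12_beta23 β μ₂ hβ', hβ']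
    congr 2
    refine LinearMap.ext fun s ↦ ?_
    simp only [LinearMap.comp_apply, LinearMap.mulLeft_apply]
    rw [HopfAlgebra.map_comulLeftQuotient_comul, HopfAlgebra.pairing_mul_comul hμ]
    rfl
  · refine TensorProduct.ext_threefold' fun p q r ↦ ?_
    simp only [LinearMap.comp_apply, LinearEquiv.coe_coe, LinearMap.lTensor_tmul]
    rw [HopfAlgebra.map_beta23_beta12 β μ₂ hβ', HopfAlgebra.map_pairing_comul hlam hμ, hβ',
      LinearMap.lTensor_comp, LinearMap.comp_apply]
end

section
/- Let X be a commutative and cocommutative Hopf algebra over a commutative ring k with S ∘ S = id, and let γ ∈ X be a two-sided cointegral. Set V = X⊗X, define ∩ : k → X⊗X by ∩(1) = Δ(γ), Δ₂ = id_X ⊗ ∩ ⊗ id_X : V → V⊗V, and let β : V⊗V → V⊗V be the braiding β(x⊗y⊗z⊗w) = z⁽¹⁾ ⊗ w⁽¹⁾ ⊗ x·S(z⁽²⁾)·w⁽²⁾ ⊗ y·S(z⁽³⁾)·w⁽³⁾. Then the comultiplication commutes with the braiding: (Δ₂ ⊗ id_V) ∘ β = (id_V ⊗ β) ∘ (β ⊗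 id_V) ∘ (id_V ⊗ Δ₂) and (id_V ⊗ Δ₂) ∘ β = (β ⊗ id_V) ∘ (id_V ⊗ β) ∘ (Δ₂ ⊗ id_V), as k-linear maps V^{⊗2} → V^{⊗3}. -/
open TensorProduct

namespace HopfPoint

open Coalgebra Bialgebra WithConv

section Point

variable {k X A C : Type*} [CommRing k] [CommRing X] [HopfAlgebra k X]
  [CommRing A] [Algebra k A] [CommRing C] [Algebra k C]

/-- Postcomposition with an algebra homomorphism, on points under convolution. -/
noncomputable def push (h : A →ₐ[k] C) :
    WithConv (X →ₐ[k] A) →* WithConv (X →ₐ[k] C) where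
  toFun p := toConv (h.comp p.ofConv)
  map_one' := by ext x; simp [AlgHom.convOne_def]
  map_mul' p q := by
    apply WithConv.ofConv_injective
    exact AlgHom.comp_convMul_distrib h p q

@[simp] lemma push_apply (h : A →ₐ[k] C) (p : WithConv (X →ₐ[k] A)) (x : X) :
    (push h p) x = h (p x) := rfl

lemma antipode_mul_self (p : WithConv (X →ₐ[k] A)) :
    toConv (p.ofConv.comp (HopfAlgebra.antipodeAlgHom k X)) * p = 1 := by
  have h := congrArg (push p.ofConv) (AlgHom.antipode_id_cancel (R := k) (A := X))
  rw [map_mul, map_one] at h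
  exact h

/-- The points of a cocommutative Hopf algebra form a commutative group. -/
noncomputable instance pointCommGroup [IsCocomm k X] : CommGroup (WithConv (X →ₐ[k] A)) where
  inv p := toConv (p.ofConv.comp (HopfAlgebra.antipodeAlgHom k X))
  inv_mul_cancel := antipode_mul_self

lemma point_mul_apply_of_rep2 (p q : WithConv (X →ₐ[k] A)) {x : X} {n : ℕ} {x1 x2 : Fin n → X}
    (h : Rep2 k x x1 x2) : (p * q) x = ∑ i, p (x1 i) * q (x2 i) := by
  rw [AlgHom.convMul_apply, h]
  simp

lemma point_mul_apply_of_rep3 (p q r : WithConv (X →ₐ[k] A)) {x : X} {n : ℕ}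
    {x1 x2 x3 : Fin n → X} (h : Rep3 k x x1 x2 x3) :
    (p * (q * r)) x = ∑ i, p (x1 i) * (q (x2 i) * r (x3 i)) := by
  have key : (p * (q * r)) x = LinearMap.mul' k A
      (TensorProduct.map p.ofConv.toLinearMap (LinearMap.mul' k A ∘ₗ
        TensorProduct.map q.ofConv.toLinearMap r.ofConv.toLinearMap) (delta3 k x)) := by
    rw [AlgHom.convMul_apply, delta3, LinearMap.comp_apply]
    induction comul (R := k) x with
    | zero => simp
    | add a b ha hb => simp only [map_add, ha, hb]
    | tmul a b =>
      simp only [Algebra.TensorProduct.lift_tmul, LinearMap.lTensor_tmul, TensorProduct.map_tmul,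
        LinearMap.mul'_apply, LinearMap.comp_apply, AlgHom.toLinearMap_apply]
      rfl
  rw [key, h]
  simp

lemma exists_rep2 (x : X) : ∃ (n : ℕ) (x1 x2 : Fin n → X), Rep2 k x x1 x2 := by
  unfold Rep2
  induction comul (R := k) x with
  | zero => exact ⟨0, ![], ![], by simp⟩
  | tmul a b => exact ⟨1, ![a], ![b], by simp⟩
  | add a b ha hb =>
    obtain ⟨n, a1, a2, rfl⟩ := ha
    obtain ⟨m, b1, b2, rfl⟩ := hb
    exact ⟨n + m, Fin.append a1 b1, Fin.append a2 b2, by simp [Fin.sum_univ_add]⟩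

lemma exists_rep3 (x : X) : ∃ (n : ℕ) (x1 x2 x3 : Fin n → X), Rep3 k x x1 x2 x3 := by
  unfold Rep3
  induction delta3 k x with
  | zero => exact ⟨0, ![], ![], ![], by simp⟩
  | tmul a b =>
    induction b with
    | zero => exact ⟨0, ![], ![], ![], by simp⟩
    | tmul b c => exact ⟨1, ![a], ![b], ![c], by simp⟩
    | add b c hb hc =>
      obtain ⟨n, a1, a2, a3, ha⟩ := hb
      obtain ⟨m, b1, b2, b3, hb⟩ := hc
      exact ⟨n + m, Fin.append a1 b1, Fin.append a2 b2, Fin.append a3 b3, by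
        simp [Fin.sum_univ_add, tmul_add, ha, hb]⟩
  | add a b ha hb =>
    obtain ⟨n, a1, a2, a3, rfl⟩ := ha
    obtain ⟨m, b1, b2, b3, rfl⟩ := hb
    exact ⟨n + m, Fin.append a1 b1, Fin.append a2 b2, Fin.append a3 b3, by
      simp [Fin.sum_univ_add]⟩

/-- If `γ` is a cointegral, every point `p` becomes trivial modulo the annihilator of `p γ`. -/
lemma push_mk_annihilator_eq_one {γ : X} (hγ : IsCointegral k γ) (p : WithConv (X →ₐ[k] A)) :
    push (Ideal.Quotient.mkₐ k (Ideal.span {p γ}).annihilator) p = 1 := by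
  ext x
  change Ideal.Quotient.mk _ (p x) = algebraMap k _ (counit (R := k) x)
  rw [← Ideal.Quotient.mk_algebraMap, Ideal.Quotient.eq, Submodule.mem_annihilator_span_singleton,
    smul_eq_mul, sub_mul, sub_eq_zero, ← Algebra.smul_def, ← map_mul, (hγ x).1, map_smul]

lemma mul_point_eq_of_comp_mk_annihilator_eq {γ : X} {p : WithConv (X →ₐ[k] A)}
    {F G : C →ₐ[k] A}
    (h : (Ideal.Quotient.mkₐ k (Ideal.span {p γ}).annihilator).comp F =
      (Ideal.Quotient.mkₐ k (Ideal.span {p γ}).annihilator).comp G) (t : C) :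
    F t * p γ = G t * p γ := by
  have ht : Ideal.Quotient.mk _ (F t) = Ideal.Quotient.mk _ (G t) := DFunLike.congr_fun h t
  rwa [Ideal.Quotient.eq, Submodule.mem_annihilator_span_singleton, smul_eq_mul, sub_mul,
    sub_eq_zero] at ht

/-- The algebra homomorphism out of `X ⊗ X` with given restrictions to the factors. -/
noncomputable abbrev ofPoints₂ (p q : WithConv (X →ₐ[k] A)) : X ⊗[k] X →ₐ[k] A :=
  Algebra.TensorProduct.productMap p.ofConv q.ofConv

/-- The algebra homomorphism out of `X^{⊗4}` with given restrictions to the factors. -/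
noncomputable def ofPoints₄ (p q r s : WithConv (X →ₐ[k] A)) :
    (X ⊗[k] X) ⊗[k] (X ⊗[k] X) →ₐ[k] A :=
  Algebra.TensorProduct.productMap (ofPoints₂ p q) (ofPoints₂ r s)

/-- The algebra homomorphism out of `X^{⊗6}` with given restrictions to the factors. -/
noncomputable def ofPoints₆ (p q r s t u : WithConv (X →ₐ[k] A)) :
    (X ⊗[k] X) ⊗[k] ((X ⊗[k] X) ⊗[k] (X ⊗[k] X)) →ₐ[k] A :=
  Algebra.TensorProduct.productMap (ofPoints₂ p q) (ofPoints₄ r s t u)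

@[simp] lemma ofPoints₄_tmul (p q r s : WithConv (X →ₐ[k] A)) (x y z w : X) :
    ofPoints₄ p q r s ((x ⊗ₜ y) ⊗ₜ (z ⊗ₜ w)) = p x * q y * (r z * s w) := by
  simp [ofPoints₄]

@[simp] lemma ofPoints₆_tmul (p q r s t u : WithConv (X →ₐ[k] A)) (a b c d e f : X) :
    ofPoints₆ p q r s t u ((a ⊗ₜ b) ⊗ₜ ((c ⊗ₜ d) ⊗ₜ (e ⊗ₜ f))) =
      p a * q b * (r c * s d * (t e * u f)) := by
  simp [ofPoints₆]

lemma comp_ofPoints₄ (h : A →ₐ[k] C) (p q r s : WithConv (X →ₐ[k] A)) :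
    h.comp (ofPoints₄ p q r s) = ofPoints₄ (push h p) (push h q) (push h r) (push h s) := by
  ext <;> simp [ofPoints₄]

end Point

section Slots

set_option synthInstance.maxHeartbeats 200000
set_option maxSynthPendingDepth 6

variable (k X : Type*) [CommRing k] [CommRing X] [HopfAlgebra k X]

/-- The inclusions of the two factors of `X ⊗ X`. -/
noncomputable def slot₂ : Fin 2 → WithConv (X →ₐ[k] X ⊗[k] X) :=
  ![toConv Algebra.TensorProduct.includeLeft, toConv Algebra.TensorProduct.includeRight]

/-- The inclusions of the four factors of `X^{⊗4}`. -/
noncomputable def slot₄ : Fin 4 → WithConv (X →ₐ[k] (X ⊗[k] X) ⊗[k] (X ⊗[k] X)) :=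
  ![push Algebra.TensorProduct.includeLeft (slot₂ k X 0),
    push Algebra.TensorProduct.includeLeft (slot₂ k X 1),
    push Algebra.TensorProduct.includeRight (slot₂ k X 0),
    push Algebra.TensorProduct.includeRight (slot₂ k X 1)]

/-- The inclusions of the six factors of `X^{⊗6}`. -/
noncomputable def slot₆ :
    Fin 6 → WithConv (X →ₐ[k] (X ⊗[k] X) ⊗[k] ((X ⊗[k] X) ⊗[k] (X ⊗[k] X))) :=
  ![push Algebra.TensorProduct.includeLeft (slot₂ k X 0),
    push Algebra.TensorProduct.includeLeft (slot₂ k X 1),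
    push Algebra.TensorProduct.includeRight (slot₄ k X 0),
    push Algebra.TensorProduct.includeRight (slot₄ k X 1),
    push Algebra.TensorProduct.includeRight (slot₄ k X 2),
    push Algebra.TensorProduct.includeRight (slot₄ k X 3)]

variable {k X} {A : Type*} [CommRing A] [Algebra k A]

lemma slot₄_apply (x : X) :
    slot₄ k X 0 x = (x ⊗ₜ 1) ⊗ₜ (1 ⊗ₜ 1) ∧ slot₄ k X 1 x = (1 ⊗ₜ x) ⊗ₜ (1 ⊗ₜ 1) ∧
    slot₄ k X 2 x = (1 ⊗ₜ 1) ⊗ₜ (x ⊗ₜ 1) ∧ slot₄ k X 3 x = (1 ⊗ₜ 1) ⊗ₜ (1 ⊗ₜ x) :=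
  ⟨rfl, rfl, rfl, rfl⟩

lemma slot₄_inv_apply (i : Fin 4) (x : X) :
    ((slot₄ k X i)⁻¹) x = slot₄ k X i (HopfAlgebra.antipode k x) := rfl

lemma slot₆_apply (x : X) :
    slot₆ k X 0 x = (x ⊗ₜ 1) ⊗ₜ ((1 ⊗ₜ 1) ⊗ₜ (1 ⊗ₜ 1)) ∧
    slot₆ k X 1 x = (1 ⊗ₜ x) ⊗ₜ ((1 ⊗ₜ 1) ⊗ₜ (1 ⊗ₜ 1)) ∧
    slot₆ k X 2 x = (1 ⊗ₜ 1) ⊗ₜ ((x ⊗ₜ 1) ⊗ₜ (1 ⊗ₜ 1)) ∧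
    slot₆ k X 3 x = (1 ⊗ₜ 1) ⊗ₜ ((1 ⊗ₜ x) ⊗ₜ (1 ⊗ₜ 1)) ∧
    slot₆ k X 4 x = (1 ⊗ₜ 1) ⊗ₜ ((1 ⊗ₜ 1) ⊗ₜ (x ⊗ₜ 1)) ∧
    slot₆ k X 5 x = (1 ⊗ₜ 1) ⊗ₜ ((1 ⊗ₜ 1) ⊗ₜ (1 ⊗ₜ x)) :=
  ⟨rfl, rfl, rfl, rfl, rfl, rfl⟩

lemma push_ofPoints₄_slot (p q r s : WithConv (X →ₐ[k] A)) :
    push (ofPoints₄ p q r s) (slot₄ k X 0) = p ∧ push (ofPoints₄ p q r s) (slot₄ k X 1) = q ∧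
    push (ofPoints₄ p q r s) (slot₄ k X 2) = r ∧ push (ofPoints₄ p q r s) (slot₄ k X 3) = s := by
  refine ⟨?_, ?_, ?_, ?_⟩ <;> ext x <;> simp [slot₄_apply]

lemma push_ofPoints₆_slot (p q r s t u : WithConv (X →ₐ[k] A)) :
    push (ofPoints₆ p q r s t u) (slot₆ k X 0) = p ∧
    push (ofPoints₆ p q r s t u) (slot₆ k X 1) = q ∧
    push (ofPoints₆ p q r s t u) (slot₆ k X 2) = r ∧
    push (ofPoints₆ p q r s t u) (slot₆ k X 3) = s ∧
    push (ofPoints₆ p q r s t u) (slot₆ k X 4) = t ∧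
    push (ofPoints₆ p q r s t u) (slot₆ k X 5) = u := by
  refine ⟨?_, ?_, ?_, ?_, ?_, ?_⟩ <;> ext x <;> simp [slot₆_apply]

variable {γ : X} {Δ₂ : X ⊗[k] X →ₗ[k] (X ⊗[k] X) ⊗[k] (X ⊗[k] X)}

lemma comul_left_apply {n : ℕ} {γ1 γ2 : Fin n → X} (hr : Rep2 k γ γ1 γ2)
    (hΔ : ∀ x w, Δ₂ (x ⊗ₜ[k] w) = ∑ i, (x ⊗ₜ[k] γ1 i) ⊗ₜ[k] (γ2 i ⊗ₜ[k] w))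
    (a : (X ⊗[k] X) ⊗[k] (X ⊗[k] X)) :
    TensorProduct.assoc k _ _ _ (TensorProduct.map Δ₂ LinearMap.id a) =
      ofPoints₄ (slot₆ k X 0) (slot₆ k X 3) (slot₆ k X 4) (slot₆ k X 5) a *
        (slot₆ k X 1 * slot₆ k X 2) γ := by
  suffices h : (TensorProduct.assoc k _ _ _).toLinearMap ∘ₗ TensorProduct.map Δ₂ LinearMap.id =
      LinearMap.mulRight k ((slot₆ k X 1 * slot₆ k X 2) γ) ∘ₗ
      (ofPoints₄ (slot₆ k X 0) (slot₆ k X 3) (slot₆ k X 4) (slot₆ k X 5)).toLinearMap from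
    DFunLike.congr_fun h a
  ext x y z w
  simp [hΔ, point_mul_apply_of_rep2 _ _ hr, slot₆_apply, sum_tmul, Finset.mul_sum]

lemma comul_right_apply {n : ℕ} {γ1 γ2 : Fin n → X} (hr : Rep2 k γ γ1 γ2)
    (hΔ : ∀ x w, Δ₂ (x ⊗ₜ[k] w) = ∑ i, (x ⊗ₜ[k] γ1 i) ⊗ₜ[k] (γ2 i ⊗ₜ[k] w))
    (a : (X ⊗[k] X) ⊗[k] (X ⊗[k] X)) :
    LinearMap.lTensor (X ⊗[k] X) Δ₂ a =
      ofPoints₄ (slot₆ k X 0) (slot₆ k X 1) (slot₆ k X 2) (slot₆ k X 5) a *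
        (slot₆ k X 3 * slot₆ k X 4) γ := by
  suffices h : LinearMap.lTensor (X ⊗[k] X) Δ₂ =
      LinearMap.mulRight k ((slot₆ k X 3 * slot₆ k X 4) γ) ∘ₗ
      (ofPoints₄ (slot₆ k X 0) (slot₆ k X 1) (slot₆ k X 2) (slot₆ k X 5)).toLinearMap from
    DFunLike.congr_fun h a
  ext x y z w
  simp [hΔ, point_mul_apply_of_rep2 _ _ hr, slot₆_apply, tmul_sum, Finset.mul_sum]

end Slots

section Braiding

set_option synthInstance.maxHeartbeats 200000
set_option maxSynthPendingDepth 6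

variable (k X : Type*) [CommRing k] [CommRing X] [HopfAlgebra k X]

/-- The braiding as an algebra endomorphism of `X^{⊗4}`. -/
noncomputable def braid :
    (X ⊗[k] X) ⊗[k] (X ⊗[k] X) →ₐ[k] (X ⊗[k] X) ⊗[k] (X ⊗[k] X) :=
  ofPoints₄ (slot₄ k X 2) (slot₄ k X 3)
    (slot₄ k X 0 * ((slot₄ k X 2)⁻¹ * (slot₄ k X 3)⁻¹))
    (slot₄ k X 1 * (slot₄ k X 2 * slot₄ k X 3))

/-- The braiding of the first two factors, as an algebra endomorphism of `X^{⊗6}`. -/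
noncomputable def braid₁₂ : (X ⊗[k] X) ⊗[k] ((X ⊗[k] X) ⊗[k] (X ⊗[k] X)) →ₐ[k]
    (X ⊗[k] X) ⊗[k] ((X ⊗[k] X) ⊗[k] (X ⊗[k] X)) :=
  ofPoints₆ (slot₆ k X 2) (slot₆ k X 3)
    (slot₆ k X 0 * ((slot₆ k X 2)⁻¹ * (slot₆ k X 3)⁻¹))
    (slot₆ k X 1 * (slot₆ k X 2 * slot₆ k X 3)) (slot₆ k X 4) (slot₆ k X 5)

/-- The braiding of the last two factors, as an algebra endomorphism of `X^{⊗6}`. -/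
noncomputable def braid₂₃ : (X ⊗[k] X) ⊗[k] ((X ⊗[k] X) ⊗[k] (X ⊗[k] X)) →ₐ[k]
    (X ⊗[k] X) ⊗[k] ((X ⊗[k] X) ⊗[k] (X ⊗[k] X)) :=
  ofPoints₆ (slot₆ k X 0) (slot₆ k X 1) (slot₆ k X 4) (slot₆ k X 5)
    (slot₆ k X 2 * ((slot₆ k X 4)⁻¹ * (slot₆ k X 5)⁻¹))
    (slot₆ k X 3 * (slot₆ k X 4 * slot₆ k X 5))

lemma push_braid₁₂_slot :
    push (braid₁₂ k X) (slot₆ k X 0) = slot₆ k X 2 ∧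
    push (braid₁₂ k X) (slot₆ k X 1) = slot₆ k X 3 ∧
    push (braid₁₂ k X) (slot₆ k X 2) =
      slot₆ k X 0 * ((slot₆ k X 2)⁻¹ * (slot₆ k X 3)⁻¹) ∧
    push (braid₁₂ k X) (slot₆ k X 3) = slot₆ k X 1 * (slot₆ k X 2 * slot₆ k X 3) ∧
    push (braid₁₂ k X) (slot₆ k X 4) = slot₆ k X 4 ∧
    push (braid₁₂ k X) (slot₆ k X 5) = slot₆ k X 5 :=
  push_ofPoints₆_slot _ _ _ _ _ _

lemma push_braid₂₃_slot :
    push (braid₂₃ k X) (slot₆ k X 0) = slot₆ k X 0 ∧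
    push (braid₂₃ k X) (slot₆ k X 1) = slot₆ k X 1 ∧
    push (braid₂₃ k X) (slot₆ k X 2) = slot₆ k X 4 ∧
    push (braid₂₃ k X) (slot₆ k X 3) = slot₆ k X 5 ∧
    push (braid₂₃ k X) (slot₆ k X 4) =
      slot₆ k X 2 * ((slot₆ k X 4)⁻¹ * (slot₆ k X 5)⁻¹) ∧
    push (braid₂₃ k X) (slot₆ k X 5) = slot₆ k X 3 * (slot₆ k X 4 * slot₆ k X 5) :=
  push_ofPoints₆_slot _ _ _ _ _ _

variable {k X}

lemma braid_tmul (x y z w : X) {n m : ℕ} {z1 z2 z3 : Fin n → X} {w1 w2 w3 : Fin m → X}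
    (hz : Rep3 k z z1 z2 z3) (hw : Rep3 k w w1 w2 w3) :
    braid k X ((x ⊗ₜ[k] y) ⊗ₜ[k] (z ⊗ₜ[k] w)) = ∑ i, ∑ j, (z1 i ⊗ₜ[k] w1 j) ⊗ₜ[k]
      ((x * HopfAlgebra.antipode k (z2 i) * w2 j) ⊗ₜ[k]
        (y * HopfAlgebra.antipode k (z3 i) * w3 j)) := by
  rw [braid, ofPoints₄_tmul, point_mul_apply_of_rep3 _ _ _ hz, point_mul_apply_of_rep3 _ _ _ hw,
    Finset.sum_mul_sum, Finset.mul_sum]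
  refine Finset.sum_congr rfl fun i _ => ?_
  rw [Finset.mul_sum]
  refine Finset.sum_congr rfl fun j _ => ?_
  simp [slot₄_apply, slot₄_inv_apply, mul_assoc]

variable [IsCocomm k X]
  {β : (X ⊗[k] X) ⊗[k] (X ⊗[k] X) →ₗ[k] (X ⊗[k] X) ⊗[k] (X ⊗[k] X)}

lemma beta12_apply (hβ : β = (braid k X).toLinearMap)
    (a : (X ⊗[k] X) ⊗[k] ((X ⊗[k] X) ⊗[k] (X ⊗[k] X))) : beta12 β a = braid₁₂ k X a := by
  have hassoc (b : (X ⊗[k] X) ⊗[k] (X ⊗[k] X)) (e f : X) :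
      TensorProduct.assoc k _ _ _ (b ⊗ₜ[k] (e ⊗ₜ[k] f)) =
        ofPoints₄ (slot₆ k X 0) (slot₆ k X 1) (slot₆ k X 2) (slot₆ k X 3) b *
          (slot₆ k X 4 e * slot₆ k X 5 f) := by
    induction b with
    | zero => simp
    | add b c hb hc => simp only [add_tmul, map_add, hb, hc, add_mul]
    | tmul u v =>
      induction u with
      | zero => simp
      | add b c hb hc => simp only [add_tmul, map_add, hb, hc, add_mul]
      | tmul x y =>
        induction v with
        | zero => simp
        | add b c hb hc => simp only [add_tmul, tmul_add, map_add, hb, hc, add_mul]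
        | tmul z w => simp [slot₆_apply]
  suffices h : beta12 β = (braid₁₂ k X).toLinearMap from DFunLike.congr_fun h a
  ext x y z w e f
  have h := congrArg (fun g => g ((x ⊗ₜ[k] y) ⊗ₜ[k] (z ⊗ₜ[k] w)))
    (comp_ofPoints₄ (ofPoints₄ (slot₆ k X 0) (slot₆ k X 1) (slot₆ k X 2) (slot₆ k X 3))
      (slot₄ k X 2) (slot₄ k X 3) (slot₄ k X 0 * ((slot₄ k X 2)⁻¹ * (slot₄ k X 3)⁻¹))
      (slot₄ k X 1 * (slot₄ k X 2 * slot₄ k X 3)))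
  simp only [map_mul, map_inv, push_ofPoints₄_slot, AlgHom.comp_apply] at h
  simp [beta12, hβ, hassoc, braid, braid₁₂] at h ⊢
  rw [h]
  ring

lemma beta23_apply (hβ : β = (braid k X).toLinearMap)
    (a : (X ⊗[k] X) ⊗[k] ((X ⊗[k] X) ⊗[k] (X ⊗[k] X))) : beta23 β a = braid₂₃ k X a := by
  have hinc (b : (X ⊗[k] X) ⊗[k] (X ⊗[k] X)) (e f : X) :
      (e ⊗ₜ[k] f) ⊗ₜ[k] b = slot₆ k X 0 e * slot₆ k X 1 f *
        (Algebra.TensorProduct.includeRight : _ →ₐ[k] (X ⊗[k] X) ⊗[k] _) b := by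
    simp [slot₆_apply, ← Algebra.TensorProduct.one_def]
  suffices h : beta23 β = (braid₂₃ k X).toLinearMap from DFunLike.congr_fun h a
  ext e f x y z w
  have h := congrArg (fun g => g ((x ⊗ₜ[k] y) ⊗ₜ[k] (z ⊗ₜ[k] w)))
    (comp_ofPoints₄ (Algebra.TensorProduct.includeRight : _ →ₐ[k] (X ⊗[k] X) ⊗[k] _)
      (slot₄ k X 2) (slot₄ k X 3) (slot₄ k X 0 * ((slot₄ k X 2)⁻¹ * (slot₄ k X 3)⁻¹))
      (slot₄ k X 1 * (slot₄ k X 2 * slot₄ k X 3)))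
  have hs : push Algebra.TensorProduct.includeRight (slot₄ k X 0) = slot₆ k X 2 ∧
    push Algebra.TensorProduct.includeRight (slot₄ k X 1) = slot₆ k X 3 ∧
    push Algebra.TensorProduct.includeRight (slot₄ k X 2) = slot₆ k X 4 ∧
    push Algebra.TensorProduct.includeRight (slot₄ k X 3) = slot₆ k X 5 := ⟨rfl, rfl, rfl, rfl⟩
  simp only [map_mul, map_inv, hs, AlgHom.comp_apply] at h
  have hb : beta23 β ((e ⊗ₜ[k] f) ⊗ₜ[k] ((x ⊗ₜ[k] y) ⊗ₜ[k] (z ⊗ₜ[k] w))) =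
      braid₂₃ k X ((e ⊗ₜ[k] f) ⊗ₜ[k] ((x ⊗ₜ[k] y) ⊗ₜ[k] (z ⊗ₜ[k] w))) := by
    rw [beta23, LinearMap.lTensor_tmul, hβ, AlgHom.toLinearMap_apply, hinc, braid, h, braid₂₃,
      ofPoints₄_tmul, ofPoints₆_tmul]
  simpa using hb

variable (k X)

lemma braid_left :
    (ofPoints₄ (slot₆ k X 0) (slot₆ k X 3) (slot₆ k X 4) (slot₆ k X 5)).comp (braid k X) =
      (braid₂₃ k X).comp ((braid₁₂ k X).comp
        (ofPoints₄ (slot₆ k X 0) (slot₆ k X 1) (slot₆ k X 2) (slot₆ k X 5))) := by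
  simp only [braid, comp_ofPoints₄, map_mul, map_inv, push_ofPoints₄_slot, push_braid₁₂_slot,
    push_braid₂₃_slot]

lemma braid_right {A : Type*} [CommRing A] [Algebra k A]
    (π : (X ⊗[k] X) ⊗[k] ((X ⊗[k] X) ⊗[k] (X ⊗[k] X)) →ₐ[k] A)
    (hπ : push π (slot₆ k X 3 * slot₆ k X 4) = 1) :
    π.comp ((ofPoints₄ (slot₆ k X 0) (slot₆ k X 1) (slot₆ k X 2) (slot₆ k X 5)).comp
      (braid k X)) = π.comp ((braid₁₂ k X).comp ((braid₂₃ k X).comp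
        (ofPoints₄ (slot₆ k X 0) (slot₆ k X 3) (slot₆ k X 4) (slot₆ k X 5)))) := by
  simp only [braid, comp_ofPoints₄, map_mul, map_inv, push_ofPoints₄_slot, push_braid₁₂_slot,
    push_braid₂₃_slot] at hπ ⊢
  rw [eq_inv_of_mul_eq_one_left hπ]
  congr 1 <;> group

lemma braid_left_apply (γ : X) (t : (X ⊗[k] X) ⊗[k] (X ⊗[k] X)) :
    ofPoints₄ (slot₆ k X 0) (slot₆ k X 3) (slot₆ k X 4) (slot₆ k X 5) (braid k X t) *
        (slot₆ k X 1 * slot₆ k X 2) γ =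
      braid₂₃ k X (braid₁₂ k X
        (ofPoints₄ (slot₆ k X 0) (slot₆ k X 1) (slot₆ k X 2) (slot₆ k X 5) t *
          (slot₆ k X 3 * slot₆ k X 4) γ)) := by
  have hp : push (braid₂₃ k X) (push (braid₁₂ k X) (slot₆ k X 3 * slot₆ k X 4)) =
      slot₆ k X 1 * slot₆ k X 2 := by
    simp only [map_mul, push_braid₁₂_slot, push_braid₂₃_slot]
    rw [mul_mul_mul_comm, ← mul_inv, mul_inv_cancel, mul_one]
  rw [map_mul, map_mul, ← push_apply (braid₁₂ k X) (slot₆ k X 3 * slot₆ k X 4),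
    ← push_apply (braid₂₃ k X) (push (braid₁₂ k X) _), hp]
  congr 1
  exact DFunLike.congr_fun (braid_left k X) t

lemma braid_right_apply {γ : X} (hγ : IsCointegral k γ) (t : (X ⊗[k] X) ⊗[k] (X ⊗[k] X)) :
    ofPoints₄ (slot₆ k X 0) (slot₆ k X 1) (slot₆ k X 2) (slot₆ k X 5) (braid k X t) *
        (slot₆ k X 3 * slot₆ k X 4) γ =
      braid₁₂ k X (braid₂₃ k X
        (ofPoints₄ (slot₆ k X 0) (slot₆ k X 3) (slot₆ k X 4) (slot₆ k X 5) t *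
          (slot₆ k X 1 * slot₆ k X 2) γ)) := by
  have hp : push (braid₁₂ k X) (push (braid₂₃ k X) (slot₆ k X 1 * slot₆ k X 2)) =
      slot₆ k X 3 * slot₆ k X 4 := by
    simp only [map_mul, push_braid₁₂_slot, push_braid₂₃_slot]
  rw [map_mul, map_mul, ← push_apply (braid₂₃ k X) (slot₆ k X 1 * slot₆ k X 2),
    ← push_apply (braid₁₂ k X) (push (braid₂₃ k X) _), hp]
  exact mul_point_eq_of_comp_mk_annihilator_eq
    (braid_right k X _ (push_mk_annihilator_eq_one hγ _)) t

end Braiding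

end HopfPoint

/-- the comultiplication `Δ₂ = id ⊗ ∩ ⊗ id` on `V = X ⊗ X` commutes with the
braiding `β`: `(Δ₂ ⊗ id) ∘ β = (id ⊗ β) ∘ (β ⊗ id) ∘ (id ⊗ Δ₂)` and
`(id ⊗ Δ₂) ∘ β = (β ⊗ id) ∘ (id ⊗ β) ∘ (Δ₂ ⊗ id)`. -/
theorem comultiplication_commutes_with_braiding (k X : Type*) [CommRing k] [CommRing X]
    [HopfAlgebra k X]
    (S : X →ₗ[k] X) (hS : S = HopfAlgebra.antipode (R := k))
    (hinv : ∀ a : X, S (S a) = a)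
    (hcc : ∀ a : X, TensorProduct.comm k X X (Coalgebra.comul a) = Coalgebra.comul a)
    (γ : X) (hγ : IsCointegral k γ)
    (Δ₂ : X ⊗[k] X →ₗ[k] (X ⊗[k] X) ⊗[k] (X ⊗[k] X))
    (hΔ₂ : ∀ (x w : X) {n : ℕ} (γ1 γ2 : Fin n → X), Rep2 k γ γ1 γ2 →
      Δ₂ (x ⊗ₜ[k] w) = ∑ i, (x ⊗ₜ[k] γ1 i) ⊗ₜ[k] (γ2 i ⊗ₜ[k] w))
    (β : (X ⊗[k] X) ⊗[k] (X ⊗[k] X) →ₗ[k] (X ⊗[k] X) ⊗[k] (X ⊗[k] X))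
    (hβ : ∀ (x y z w : X) {n m : ℕ} (z1 z2 z3 : Fin n → X) (w1 w2 w3 : Fin m → X),
      Rep3 k z z1 z2 z3 → Rep3 k w w1 w2 w3 →
      β ((x ⊗ₜ[k] y) ⊗ₜ[k] (z ⊗ₜ[k] w)) =
        ∑ i, ∑ j, (z1 i ⊗ₜ[k] w1 j) ⊗ₜ[k]
          ((x * S (z2 i) * w2 j) ⊗ₜ[k] (y * S (z3 i) * w3 j))) :
    ((TensorProduct.assoc k (X ⊗[k] X) (X ⊗[k] X) (X ⊗[k] X)).toLinearMap ∘ₗ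
        TensorProduct.map Δ₂ LinearMap.id ∘ₗ β =
      beta23 β ∘ₗ beta12 β ∘ₗ LinearMap.lTensor (X ⊗[k] X) Δ₂) ∧
    (LinearMap.lTensor (X ⊗[k] X) Δ₂ ∘ₗ β =
      beta12 β ∘ₗ beta23 β ∘ₗ
        (TensorProduct.assoc k (X ⊗[k] X) (X ⊗[k] X) (X ⊗[k] X)).toLinearMap ∘ₗ
          TensorProduct.map Δ₂ LinearMap.id) := by
  have : Coalgebra.IsCocomm k X := ⟨LinearMap.ext hcc⟩
  subst hS
  obtain ⟨n, γ1, γ2, hr⟩ := HopfPoint.exists_rep2 (k := k) γ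
  have hΔ (x w : X) := hΔ₂ x w γ1 γ2 hr
  have hb : β = (HopfPoint.braid k X).toLinearMap := by
    ext x y z w
    obtain ⟨n, z1, z2, z3, hz⟩ := HopfPoint.exists_rep3 (k := k) z
    obtain ⟨m, w1, w2, w3, hw⟩ := HopfPoint.exists_rep3 (k := k) w
    exact (hβ x y z w z1 z2 z3 w1 w2 w3 hz hw).trans (HopfPoint.braid_tmul x y z w hz hw).symm
  constructor
  · refine LinearMap.ext fun t => ?_
    simp only [LinearMap.comp_apply, LinearEquiv.coe_coe, HopfPoint.beta12_apply hb,
      HopfPoint.beta23_apply hb, HopfPoint.comul_left_apply hr hΔ,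
      HopfPoint.comul_right_apply hr hΔ]
    rw [hb]
    exact HopfPoint.braid_left_apply k X γ t
  · refine LinearMap.ext fun t => ?_
    simp only [LinearMap.comp_apply, LinearEquiv.coe_coe, HopfPoint.beta12_apply hb,
      HopfPoint.beta23_apply hb, HopfPoint.comul_left_apply hr hΔ,
      HopfPoint.comul_right_apply hr hΔ]
    rw [hb]
    exact HopfPoint.braid_right_apply k X hγ t
end
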